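/- Let H be a finite-dimensional Hopf algebra over a field k with bijective antipode, and let J ∈ H ⊗ H be a twist for H, i.e. J is invertible in the algebra H ⊗ H and satisfies (Δ ⊗ id)(J)·(J ⊗ 1) = (id ⊗ Δ)(J)·(1 ⊗ J) and (ε ⊗ id)(J) = (id ⊗ ε)(J) = 1. Let H^J be a Hopf algebra over k whose underlying algebra is that of H, whose counit is ε, whose comultiplication is Δ^J(x) = J^{-1} Δ(x) J (products taken in the algebra H ⊗ H), and whose antipode is bijective. Then exp(H^J) = exp(H). -/

import Mathlib

open TensorProduct

noncomputable section

variable (k H : Type*) [CommSemiring k] [Semiring H] [Bialgebra k H]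

/-- Convolution product of two linear endomorphisms of a bialgebra:
`(f ⋆ g)(x) = ∑ f(x⁽¹⁾) g(x⁽²⁾)`, i.e. `m ∘ (f ⊗ g) ∘ Δ`. -/
def conv (f g : H →ₗ[k] H) : H →ₗ[k] H :=
  LinearMap.mul' k H ∘ₗ TensorProduct.map f g ∘ₗ Coalgebra.comul

/-- `expMap k H Sinv n` is the map `m_n ∘ (id ⊗ Sinv² ⊗ Sinv⁴ ⊗ ⋯ ⊗ Sinv^{2n-2}) ∘ Δ_n`
(defined by the recursion `m_1 = Δ_1 = id`, `m_n = m ∘ (m_{n-1} ⊗ id)`,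
`Δ_n = (Δ_{n-1} ⊗ id) ∘ Δ`). -/
def expMap (Sinv : H →ₗ[k] H) : ℕ → (H →ₗ[k] H)
  | 0 => 0
  | 1 => LinearMap.id
  | (n+2) => conv k H (expMap Sinv (n+1)) ((Sinv ∘ₗ Sinv) ^ (n+1))

/-- The map `x ↦ ε(x)·1`. -/
def counitUnit : H →ₗ[k] H := Algebra.linearMap k H ∘ₗ Coalgebra.counit

/-- The exponent of a Hopf algebra (with `Sinv` the inverse of the antipode):
the least `n > 0` with `m_n ∘ (id ⊗ S⁻² ⊗ ⋯ ⊗ S^{-2n+2}) ∘ Δ_n = ε(·)1`.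
By convention `hopfExponent = 0` when no such `n` exists (i.e. `exp(H) = ∞`). -/
def hopfExponent (Sinv : H →ₗ[k] H) : ℕ :=
  sInf {n : ℕ | 0 < n ∧ expMap k H Sinv n = counitUnit k H}


namespace HT
universe u

section Ev
variable {k : Type u} [Field k] {P Q C C' : Type u} [Ring C] [Algebra k C] [Ring C'] [Algebra k C']

/-- multiplicative unital linear map -/
structure Mlt {P C : Type u} [Ring P] [Algebra k P] [Ring C] [Algebra k C] (F : P →ₗ[k] C) :
    Prop where
  one : F 1 = 1
  mul : ∀ x y, F (x * y) = F x * F y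

/-- elementwise commuting maps -/
def Cm {P Q C : Type u} [Ring C] [Algebra k C] [AddCommGroup P] [Module k P]
    [AddCommGroup Q] [Module k Q] (F : P →ₗ[k] C) (G : Q →ₗ[k] C) : Prop :=
  ∀ x y, F x * G y = G y * F x

section
variable [AddCommGroup P] [Module k P] [AddCommGroup Q] [Module k Q]

def ev (F : P →ₗ[k] C) (G : Q →ₗ[k] C) : P ⊗[k] Q →ₗ[k] C :=
  LinearMap.mul' k C ∘ₗ TensorProduct.map F G

def lm (c : C) (F : P →ₗ[k] C) : P →ₗ[k] C := LinearMap.mulLeft k c ∘ₗ F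
def rm (F : P →ₗ[k] C) (c : C) : P →ₗ[k] C := LinearMap.mulRight k c ∘ₗ F

@[simp] lemma lm_apply (c : C) (F : P →ₗ[k] C) (x : P) : lm c F x = c * F x := rfl
@[simp] lemma rm_apply (c : C) (F : P →ₗ[k] C) (x : P) : rm F c x = F x * c := rfl

@[simp] lemma ev_tmul (F : P →ₗ[k] C) (G : Q →ₗ[k] C) (x : P) (y : Q) :
    ev F G (x ⊗ₜ y) = F x * G y := rfl

lemma ev_lm (F : P →ₗ[k] C) (G : Q →ₗ[k] C) (c : C) : ev (lm c F) G = lm c (ev F G) := by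
  ext x y; simp [mul_assoc]
lemma ev_rm (F : P →ₗ[k] C) (G : Q →ₗ[k] C) (c : C) : ev F (rm G c) = rm (ev F G) c := by
  ext x y; simp [mul_assoc]
lemma ev_mid (F : P →ₗ[k] C) (G : Q →ₗ[k] C) (c : C) : ev (rm F c) G = ev F (lm c G) := by
  ext x y; simp [mul_assoc]
lemma Cm.symm {F : P →ₗ[k] C} {G : Q →ₗ[k] C} (h : Cm F G) : Cm G F := fun x y => (h y x).symm

lemma ev_comm {F : P →ₗ[k] C} {G : Q →ₗ[k] C} (h : Cm F G) (z : P ⊗[k] Q) :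
    ev F G z = ev G F (TensorProduct.comm k P Q z) := by
  induction z with
  | zero => simp
  | add x y hx hy => simp [hx, hy]
  | tmul x y => simpa using h x y

lemma ev_commute {F : P →ₗ[k] C} {G : Q →ₗ[k] C} {c : C} (h1 : ∀ x, c * F x = F x * c)
    (h2 : ∀ x, c * G x = G x * c) (z : P ⊗[k] Q) : c * ev F G z = ev F G z * c := by
  induction z with
  | zero => simp
  | add x y hx hy => simp [hx, hy, mul_add, add_mul]
  | tmul x y => simp only [ev_tmul]; rw [← mul_assoc, h1, mul_assoc, h2, mul_assoc]

lemma Cm.ev {T : Type u} [AddCommGroup T] [Module k T] {F : P →ₗ[k] C} {G : Q →ₗ[k] C}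
    {K : T →ₗ[k] C} (h1 : Cm K F) (h2 : Cm K G) : Cm K (ev F G) :=
  fun x z => ev_commute (h1 x) (h2 x) z

lemma Cm.comp {T T' : Type u} [AddCommGroup T] [Module k T] [AddCommGroup T'] [Module k T']
    {F : P →ₗ[k] C} {G : Q →ₗ[k] C}
    (h : Cm F G) (f : T →ₗ[k] P) (g : T' →ₗ[k] Q) : Cm (F ∘ₗ f) (G ∘ₗ g) :=
  fun x y => h (f x) (g y)

lemma ev_map {T T' : Type u} [AddCommGroup T] [Module k T] [AddCommGroup T'] [Module k T']
    (F : P →ₗ[k] C) (G : Q →ₗ[k] C) (f : T →ₗ[k] P) (g : T' →ₗ[k] Q) (z) :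
    ev F G (TensorProduct.map f g z) = ev (F ∘ₗ f) (G ∘ₗ g) z := by
  induction z with
  | zero => simp
  | add x y hx hy => simp [hx, hy]
  | tmul x y => simp

lemma map_ev {φ : C →ₗ[k] C'} (hφ : Mlt φ) (F : P →ₗ[k] C) (G : Q →ₗ[k] C) (z : P ⊗[k] Q) :
    φ (ev F G z) = ev (φ ∘ₗ F) (φ ∘ₗ G) z := by
  induction z with
  | zero => simp
  | add x y hx hy => simp [hx, hy]
  | tmul x y => simp [hφ.mul]

end

lemma Mlt.ofAlgHom {P : Type u} [Ring P] [Algebra k P] (f : P →ₐ[k] C) : Mlt f.toLinearMap :=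
  ⟨by simp, by simp⟩

lemma Mlt.comp {P : Type u} [Ring P] [Algebra k P] {g : C →ₗ[k] C'} {f : P →ₗ[k] C}
    (hg : Mlt g) (hf : Mlt f) :
    Mlt (g ∘ₗ f) := ⟨by simp [hf.one, hg.one], by simp [hf.mul, hg.mul]⟩

lemma Mlt.ev {P Q : Type u} [Ring P] [Algebra k P] [Ring Q] [Algebra k Q]
    {F : P →ₗ[k] C} {G : Q →ₗ[k] C} (hF : Mlt F) (hG : Mlt G) (h : Cm F G) : Mlt (ev F G) := by
  refine ⟨?_, ?_⟩
  · simp [Algebra.TensorProduct.one_def, hF.one, hG.one]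
  · intro z w
    induction z with
    | zero => simp
    | add x y hx hy => simp [hx, hy, add_mul]
    | tmul x y =>
      induction w with
      | zero => simp
      | add x y hx hy => simp [hx, hy, mul_add]
      | tmul x' y' =>
        simp only [Algebra.TensorProduct.tmul_mul_tmul, ev_tmul, hF.mul, hG.mul]
        rw [mul_assoc, mul_assoc, ← mul_assoc (F x') (G y), h, mul_assoc]

def iL (k A B : Type u) [Field k] [Ring A] [Algebra k A] [Ring B] [Algebra k B] :
    A →ₗ[k] A ⊗[k] B := (Algebra.TensorProduct.includeLeft : A →ₐ[k] A ⊗[k] B).toLinearMap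
def iR (k A B : Type u) [Field k] [Ring A] [Algebra k A] [Ring B] [Algebra k B] :
    B →ₗ[k] A ⊗[k] B := (Algebra.TensorProduct.includeRight : B →ₐ[k] A ⊗[k] B).toLinearMap

variable {A B : Type u} [Ring A] [Algebra k A] [Ring B] [Algebra k B]
@[simp] lemma iL_apply (a : A) : iL k A B a = a ⊗ₜ 1 := rfl
@[simp] lemma iR_apply (b : B) : iR k A B b = 1 ⊗ₜ b := rfl
lemma mlt_iL : Mlt (iL k A B) := Mlt.ofAlgHom _
lemma mlt_iR : Mlt (iR k A B) := Mlt.ofAlgHom _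
lemma cm_i : Cm (iL k A B) (iR k A B) := fun x y => by simp
lemma ev_i (z : A ⊗[k] B) : ev (iL k A B) (iR k A B) z = z := by
  induction z with
  | zero => simp
  | add x y hx hy => rw [map_add, hx, hy]
  | tmul x y => simp
lemma ev_iL (F : A →ₗ[k] C) (G : B →ₗ[k] C) (hG : Mlt G) : ev F G ∘ₗ iL k A B = F := by
  ext x; simp [hG.one]
lemma ev_iR (F : A →ₗ[k] C) (G : B →ₗ[k] C) (hF : Mlt F) : ev F G ∘ₗ iR k A B = G := by
  ext x; simp [hF.one]
end Ev

section Cv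
variable {k H C C' : Type u} [Field k] [Ring H] [Bialgebra k H] [Ring C] [Algebra k C]
  [Ring C'] [Algebra k C']

def cv (F G : H →ₗ[k] C) : H →ₗ[k] C := ev F G ∘ₗ Coalgebra.comul

def eps (k H C : Type u) [Field k] [Ring H] [Bialgebra k H] [Ring C] [Algebra k C] : H →ₗ[k] C :=
  Algebra.linearMap k C ∘ₗ Coalgebra.counit

lemma cv_apply (F G : H →ₗ[k] C) (x : H) : cv F G x = ev F G (Coalgebra.comul x) := rfl
lemma eps_apply (x : H) : eps k H C x = algebraMap k C (Coalgebra.counit x) := rfl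

lemma cv_eq (F G : H →ₗ[k] C) : cv F G = (WithConv.toConv F * WithConv.toConv G).ofConv := rfl
lemma eps_eq : eps k H C = (1 : WithConv (H →ₗ[k] C)).ofConv := rfl

lemma cv_assoc (F G K : H →ₗ[k] C) : cv (cv F G) K = cv F (cv G K) := by
  simp only [cv_eq, WithConv.toConv_ofConv, mul_assoc]
lemma cv_eps (F : H →ₗ[k] C) : cv F (eps k H C) = F := by
  simp only [cv_eq, eps_eq, WithConv.toConv_ofConv, mul_one, WithConv.ofConv_toConv]
lemma eps_cv (F : H →ₗ[k] C) : cv (eps k H C) F = F := by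
  simp only [cv_eq, eps_eq, WithConv.toConv_ofConv, one_mul, WithConv.ofConv_toConv]
lemma cv_lm (c : C) (F G : H →ₗ[k] C) : cv (lm c F) G = lm c (cv F G) := by
  simp only [cv, ev_lm]; rfl
lemma cv_rm (c : C) (F G : H →ₗ[k] C) : cv F (rm G c) = rm (cv F G) c := by
  simp only [cv, ev_rm]; rfl
lemma cv_mid (c : C) (F G : H →ₗ[k] C) : cv (rm F c) G = cv F (lm c G) := by
  simp only [cv, ev_mid]
lemma map_cv {φ : C →ₗ[k] C'} (hφ : Mlt φ) (F G : H →ₗ[k] C) :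
    φ ∘ₗ (cv F G) = cv (φ ∘ₗ F) (φ ∘ₗ G) := by
  ext x; exact map_ev hφ _ _ _
lemma map_eps {φ : C →ₗ[k] C'} (hφ : Mlt φ) : φ ∘ₗ eps k H C = eps k H C' := by
  ext x; simp [eps_apply, Algebra.algebraMap_eq_smul_one, hφ.one]
lemma Mlt.cv {F G : H →ₗ[k] C} (hF : Mlt F) (hG : Mlt G) (h : Cm F G) : Mlt (cv F G) :=
  (hF.ev hG h).comp (Mlt.ofAlgHom (Bialgebra.comulAlgHom k H))
lemma Cm.cv {T : Type u} [AddCommGroup T] [Module k T] {K : T →ₗ[k] C} {F G : H →ₗ[k] C}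
    (h1 : Cm K F) (h2 : Cm K G) : Cm K (cv F G) := fun x y => (h1.ev h2) x _
lemma mlt_eps : Mlt (eps k H C) :=
  Mlt.ofAlgHom ((Algebra.ofId k C).comp (Bialgebra.counitAlgHom k H))

lemma cv_i : cv (iL k H H) (iR k H H) = Coalgebra.comul := by
  ext x; exact ev_i _
end Cv

section YD
variable {k H : Type u} [Field k] [Ring H] [Bialgebra k H]
  {A : Type u} [Ring A] [Algebra k A] {C : Type u} [Ring C] [Algebra k C]

structure IsYD (ι : H →ₗ[k] A) (R : A ⊗[k] H) : Prop where
  mi : Mlt ι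
  hmul : ∀ (C : Type u) [Ring C] [Algebra k C] (j : A →ₗ[k] C) (f g : H →ₗ[k] C),
    Mlt j → Mlt f → Mlt g → Cm j f → Cm j g → Cm f g → ev j f R * ev j g R = ev j (cv f g) R
  hyd : ∀ (C : Type u) [Ring C] [Algebra k C] (j : A →ₗ[k] C) (f : H →ₗ[k] C),
    Mlt j → Mlt f → Cm j f → ∀ h, ev j f R * cv f (j ∘ₗ ι) h = cv (j ∘ₗ ι) f h * ev j f R
  hone : ev LinearMap.id (eps k H A) R = 1

lemma mlt_id : Mlt (LinearMap.id : C →ₗ[k] C) := ⟨rfl, fun _ _ => rfl⟩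

lemma IsYD.hone' {ι : H →ₗ[k] A} {R : A ⊗[k] H} (h : IsYD ι R) {j : A →ₗ[k] C} (hj : Mlt j) :
    ev j (eps k H C) R = 1 := by
  have := congrArg j h.hone
  rwa [map_ev hj, hj.one, map_eps hj] at this

def psi (R : A ⊗[k] H) (j : A →ₗ[k] C) (F : H →ₗ[k] C) (z : C) : C :=
  ev F (lm z j) (TensorProduct.comm k A H R)

def cvop (F G : H →ₗ[k] C) : H →ₗ[k] C :=
  ev F G ∘ₗ (TensorProduct.comm k H H).toLinearMap ∘ₗ Coalgebra.comul

@[simp] lemma psi_tmul (d : A) (a : H) (j : A →ₗ[k] C) (F : H →ₗ[k] C) (z : C) :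
    psi (d ⊗ₜ a) j F z = F a * (z * j d) := rfl
@[simp] lemma psi_zero (j : A →ₗ[k] C) (F : H →ₗ[k] C) (z : C) :
    psi (0 : A ⊗[k] H) j F z = 0 := by simp [psi]
@[simp] lemma psi_add (x y : A ⊗[k] H) (j : A →ₗ[k] C) (F : H →ₗ[k] C) (z : C) :
    psi (x + y) j F z = psi x j F z + psi y j F z := by simp [psi]
lemma lm_add (x y : C) (j : A →ₗ[k] C) : lm (x + y) j = lm x j + lm y j := by
  ext; simp [add_mul]
lemma psi_addz (R : A ⊗[k] H) (j : A →ₗ[k] C) (F : H →ₗ[k] C) (z w : C) :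
    psi R j F (z + w) = psi R j F z + psi R j F w := by
  induction R with
  | zero => simp
  | add x y hx hy => simp [hx, hy]; abel
  | tmul x y => simp [mul_add, add_mul]
lemma psi_zeroz (R : A ⊗[k] H) (j : A →ₗ[k] C) (F : H →ₗ[k] C) :
    psi R j F 0 = 0 := by
  induction R with
  | zero => simp
  | add x y hx hy => simp [hx, hy]
  | tmul x y => simp

/-- universal form of multiplicativity -/
lemma IsYD.univ {ι : H →ₗ[k] A} {R : A ⊗[k] H} (h : IsYD ι R) :
    ev (iL k A (H ⊗[k] H)) (iR k A (H ⊗[k] H) ∘ₗ iL k H H) R *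
      ev (iL k A (H ⊗[k] H)) (iR k A (H ⊗[k] H) ∘ₗ iR k H H) R =
    TensorProduct.map LinearMap.id (Coalgebra.comul) R := by
  rw [h.hmul _ _ _ _ mlt_iL (mlt_iR.comp mlt_iL) (mlt_iR.comp mlt_iR)
    (fun x y => by simp) (fun x y => by simp) (fun x y => by simp), ← map_cv mlt_iR, cv_i]
  generalize R = w
  induction w with
  | zero => simp
  | add x y hx hy => rw [map_add, hx, hy, map_add]
  | tmul x y => simp

lemma IsYD.psi_psi {ι : H →ₗ[k] A} {R : A ⊗[k] H} (h : IsYD ι R) {j : A →ₗ[k] C} (hj : Mlt j)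
    (F G : H →ₗ[k] C) (z : C) : psi R j F (psi R j G z) = psi R j (cvop F G) z := by
  let L : A ⊗[k] (H ⊗[k] H) →ₗ[k] C :=
    ev (ev F G ∘ₗ (TensorProduct.comm k H H).toLinearMap) (lm z j) ∘ₗ
      (TensorProduct.comm k A (H ⊗[k] H)).toLinearMap
  have h1 : ∀ v w : A ⊗[k] H, L (ev (iL k A (H ⊗[k] H)) (iR k A (H ⊗[k] H) ∘ₗ iL k H H) v *
      ev (iL k A (H ⊗[k] H)) (iR k A (H ⊗[k] H) ∘ₗ iR k H H) w) = psi w j F (psi v j G z) := by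
    intro v w
    induction v with
    | zero => simp [psi_zeroz]
    | add x y hx hy => simp only [map_add, add_mul, hx, hy, psi_add, psi_addz]
    | tmul x y =>
      induction w with
      | zero => simp
      | add x y hx hy => simp only [map_add, mul_add, hx, hy, psi_add]
      | tmul x' y' => simp [L, mul_assoc, hj.mul]
  have h2 : ∀ w : A ⊗[k] H, L (TensorProduct.map LinearMap.id (Coalgebra.comul) w) =
      psi w j (cvop F G) z := by
    intro w
    induction w with
    | zero => simp
    | add x y hx hy => simp only [map_add, hx, hy, psi_add]
    | tmul x y => simp [L, cvop]
  rw [← h1, h.univ, h2]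

lemma IsYD.hmul' {ι : H →ₗ[k] A} {R : A ⊗[k] H} (h : IsYD ι R) {j : A →ₗ[k] C} (hj : Mlt j)
    {f g : H →ₗ[k] C} (hf : Cm j f) : ev j f R * ev j g R = ev j (cv f g) R := by
  let L : A ⊗[k] (H ⊗[k] H) →ₗ[k] C := ev j (ev f g)
  have h1 : ∀ v w : A ⊗[k] H, L (ev (iL k A (H ⊗[k] H)) (iR k A (H ⊗[k] H) ∘ₗ iL k H H) v *
      ev (iL k A (H ⊗[k] H)) (iR k A (H ⊗[k] H) ∘ₗ iR k H H) w) = ev j f v * ev j g w := by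
    intro v w
    induction v with
    | zero => simp
    | add x y hx hy => simp only [map_add, add_mul, hx, hy]
    | tmul x y =>
      induction w with
      | zero => simp
      | add x y hx hy => simp only [map_add, mul_add, hx, hy]
      | tmul x' y' =>
        simp [L, hj.mul]
        rw [mul_assoc, mul_assoc, ← mul_assoc (j x'), hf, mul_assoc]
  rw [← h1, h.univ]
  simp only [L, ev_map]; rfl

lemma IsYD.psi_eps {ι : H →ₗ[k] A} {R : A ⊗[k] H} (h : IsYD ι R) {j : A →ₗ[k] C} (hj : Mlt j)
    (z : C) : psi R j (eps k H C) z = z := by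
  have : ∀ w : A ⊗[k] H, psi w j (eps k H C) z = z * ev j (eps k H C) w := by
    intro w
    induction w with
    | zero => simp
    | add x y hx hy => simp [hx, hy, mul_add]
    | tmul x y =>
      simp only [psi_tmul, ev_tmul, eps_apply, Algebra.algebraMap_eq_smul_one]
      simp
  rw [this, h.hone' hj, mul_one]
end YD

section Hopf
variable {k H : Type u} [Field k] [Ring H] [HopfAlgebra k H]
  {A : Type u} [Ring A] [Algebra k A] {C : Type u} [Ring C] [Algebra k C]
  {C' : Type u} [Ring C'] [Algebra k C']

lemma cvop_op (F G : H →ₗ[k] C) : (MulOpposite.opLinearEquiv k).toLinearMap ∘ₗ cvop F G =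
    cv ((MulOpposite.opLinearEquiv k).toLinearMap ∘ₗ G)
      ((MulOpposite.opLinearEquiv k).toLinearMap ∘ₗ F) := by
  ext x
  simp only [cvop, cv, LinearMap.comp_apply]
  generalize (Coalgebra.comul x : H ⊗[k] H) = z
  induction z with
  | zero => simp
  | add x y hx hy => simp only [map_add, hx, hy]
  | tmul x y => simp

lemma op_inj {F G : H →ₗ[k] C} (h : (MulOpposite.opLinearEquiv k).toLinearMap ∘ₗ F =
    (MulOpposite.opLinearEquiv k).toLinearMap ∘ₗ G) : F = G := by
  ext x
  exact (MulOpposite.opLinearEquiv k).injective (LinearMap.congr_fun h x)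

lemma op_eps : (MulOpposite.opLinearEquiv k).toLinearMap ∘ₗ eps k H C = eps k H Cᵐᵒᵖ := by
  ext x; simp [eps_apply]

lemma cvop_assoc (F G K : H →ₗ[k] C) : cvop (cvop F G) K = cvop F (cvop G K) := by
  apply op_inj; simp only [cvop_op, cv_assoc]
lemma cvop_eps (F : H →ₗ[k] C) : cvop F (eps k H C) = F := by
  apply op_inj; simp only [cvop_op, op_eps, eps_cv]
lemma eps_cvop (F : H →ₗ[k] C) : cvop (eps k H C) F = F := by
  apply op_inj; simp only [cvop_op, op_eps, cv_eps]
lemma map_cvop {φ : C →ₗ[k] C'} (hφ : Mlt φ) (F G : H →ₗ[k] C) :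
    φ ∘ₗ (cvop F G) = cvop (φ ∘ₗ F) (φ ∘ₗ G) := by
  ext x; exact map_ev hφ _ _ _
lemma cvop_cm {F G : H →ₗ[k] C} (h : Cm F G) : cvop F G = cv G F := by
  ext x
  simp only [cvop, cv, LinearMap.comp_apply]
  exact (ev_comm h.symm _).symm

structure IsInv (s : H →ₗ[k] H) : Prop where
  h1 : ∀ x, s (HopfAlgebra.antipode k x) = x
  h2 : ∀ x, HopfAlgebra.antipode k (s x) = x

variable {s : H →ₗ[k] H} (hs : IsInv s)
include hs

lemma IsInv.one : s 1 = 1 := by simpa using hs.h1 1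
lemma IsInv.mul (x y : H) : s (x * y) = s y * s x := by
  have := hs.h1 (s y * s x)
  rwa [HopfAlgebra.antipode_mul_antidistrib, hs.h2, hs.h2] at this
lemma IsInv.counit (x : H) : Coalgebra.counit (R := k) (s x) = Coalgebra.counit (R := k) x := by
  rw [← HopfAlgebra.counit_antipode, hs.h2]
lemma IsInv.mss : Mlt (s ∘ₗ s) := ⟨by simp [hs.one], by simp [hs.mul]⟩

lemma IsInv.inj {x y : H} (h : HopfAlgebra.antipode k x = HopfAlgebra.antipode k y) : x = y := by
  rw [← hs.h1 x, h, hs.h1]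

lemma IsInv.s_id : cvop s LinearMap.id = eps k H H := by
  ext x
  apply hs.inj
  have : ∀ z : H ⊗[k] H, HopfAlgebra.antipode k (ev s LinearMap.id (TensorProduct.comm k H H z)) =
      ev (HopfAlgebra.antipode k) LinearMap.id z := by
    intro z
    induction z with
    | zero => simp
    | add x y hx hy => simp [hx, hy]
    | tmul x y => simp [HopfAlgebra.antipode_mul_antidistrib, hs.h2]
  have h3 := this (Coalgebra.comul x)
  have h4 := HopfAlgebra.mul_antipode_rTensor_comul_apply (R := k) x
  simp only [eps_apply]
  refine h3.trans (Eq.trans h4 ?_)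
  simp [Algebra.algebraMap_eq_smul_one]

lemma IsInv.id_s : cvop LinearMap.id s = eps k H H := by
  ext x
  apply hs.inj
  have : ∀ z : H ⊗[k] H, HopfAlgebra.antipode k (ev LinearMap.id s (TensorProduct.comm k H H z)) =
      ev LinearMap.id (HopfAlgebra.antipode k) z := by
    intro z
    induction z with
    | zero => simp
    | add x y hx hy => simp [hx, hy]
    | tmul x y => simp [HopfAlgebra.antipode_mul_antidistrib, hs.h2]
  have h3 := this (Coalgebra.comul x)
  have h4 := HopfAlgebra.mul_antipode_lTensor_comul_apply (R := k) x
  simp only [eps_apply]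
  refine h3.trans (Eq.trans h4 ?_)
  simp [Algebra.algebraMap_eq_smul_one]

lemma IsInv.keyS : cvop (Coalgebra.comul ∘ₗ s) (iR k H H) = iL k H H ∘ₗ s := by
  have hΔ : Mlt (Coalgebra.comul : H →ₗ[k] H ⊗[k] H) := Mlt.ofAlgHom (Bialgebra.comulAlgHom k H)
  have h1 : cvop (iR k H H) (iL k H H) = Coalgebra.comul := by rw [cvop_cm cm_i.symm, cv_i]
  have h2 : cvop Coalgebra.comul (iL k H H ∘ₗ s) = iR k H H := by
    rw [← h1, cvop_assoc]
    have : cvop (iL k H H) (iL k H H ∘ₗ s) = eps k H _ := by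
      have := map_cvop (mlt_iL (k := k) (A := H) (B := H)) LinearMap.id s
      rw [hs.id_s, map_eps mlt_iL] at this
      exact this.symm
    rw [this, cvop_eps]
  have h3 : cvop (Coalgebra.comul ∘ₗ s) (Coalgebra.comul : H →ₗ[k] H ⊗[k] H) = eps k H _ := by
    have := map_cvop hΔ s LinearMap.id
    rw [hs.s_id, map_eps hΔ] at this
    exact this.symm
  rw [← h2, ← cvop_assoc, h3, eps_cvop]

lemma IsInv.s_cv (F G : H →ₗ[k] H) : s ∘ₗ cv F G = cvop (s ∘ₗ G) (s ∘ₗ F) := by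
  ext x
  simp only [cvop, cv, LinearMap.comp_apply]
  generalize (Coalgebra.comul x : H ⊗[k] H) = z
  induction z with
  | zero => simp
  | add x y hx hy => simp only [map_add, hx, hy]
  | tmul x y => simp [hs.mul]

omit hs in
lemma psi_commute {c : C} {F F' : H →ₗ[k] C} (h : ∀ a, c * F a = F' a * c) (R : A ⊗[k] H)
    (j : A →ₗ[k] C) (z : C) : c * psi R j F z = psi R j F' (c * z) := by
  induction R with
  | zero => simp
  | add x y hx hy => simp only [psi_add, mul_add, hx, hy]
  | tmul x y => simp only [psi_tmul, ← mul_assoc, h]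

omit hs in
lemma psi_right {c : C} {j : A →ₗ[k] C} (h : ∀ d, c * j d = j d * c) (R : A ⊗[k] H)
    (F : H →ₗ[k] C) (z : C) : psi R j F (z * c) = psi R j F z * c := by
  induction R with
  | zero => simp
  | add x y hx hy => simp only [psi_add, add_mul, hx, hy]
  | tmul x y => simp only [psi_tmul, mul_assoc, h]

omit hs in
lemma psi_smul (c : k) (j : A →ₗ[k] C) (R : A ⊗[k] H)
    (F : H →ₗ[k] C) (z : C) : psi R j F (c • z) = c • psi R j F z := by
  induction R with
  | zero => simp
  | add x y hx hy => simp only [psi_add, hx, hy, smul_add]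
  | tmul x y => simp

omit hs in
lemma map_psi {φ : C →ₗ[k] C'} (hφ : Mlt φ) (R : A ⊗[k] H) (j : A →ₗ[k] C)
    (F : H →ₗ[k] C) (z : C) : φ (psi R j F z) = psi R (φ ∘ₗ j) (φ ∘ₗ F) (φ z) := by
  induction R with
  | zero => simp
  | add x y hx hy => simp only [psi_add, map_add, hx, hy]
  | tmul x y => simp [hφ.mul]

omit hs in
def phi (s : H →ₗ[k] H) (ι : H →ₗ[k] A) (R : A ⊗[k] H) : A := psi R LinearMap.id (ι ∘ₗ s) 1

lemma phi_aux {ι : H →ₗ[k] A} {R : A ⊗[k] H} (h : IsYD ι R) :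
    cv (ι ∘ₗ s) (lm (phi s ι R) ι) = lm (phi s ι R) (eps k H A) := by
  ext x
  have h0 := h.hyd _ (iL k A H) (iR k A H) mlt_iL mlt_iR cm_i x
  rw [ev_i] at h0
  have h1 : ∀ (w : A ⊗[k] H) (z : H ⊗[k] H),
      psi (w * ev (iR k A H) (iL k A H ∘ₗ ι) z) LinearMap.id (ι ∘ₗ s) 1 =
      ev (ι ∘ₗ s) (lm (psi w LinearMap.id (ι ∘ₗ s) 1) ι) z := by
    intro w z
    induction z with
    | zero => simp
    | add x y hx hy => simp only [psi_add, map_add, mul_add, hx, hy]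
    | tmul x y =>
      induction w with
      | zero => simp
      | add x y hx hy =>
        simp only [ev_tmul, lm_apply] at hx hy ⊢
        simp only [add_mul, psi_add, hx, hy, mul_add]
      | tmul x' y' => simp [hs.mul, h.mi.mul, mul_assoc]
  have h2 : ∀ (w : A ⊗[k] H) (z : H ⊗[k] H),
      psi (ev (iL k A H ∘ₗ ι) (iR k A H) z * w) LinearMap.id (ι ∘ₗ s) 1 =
      psi w LinearMap.id (ι ∘ₗ s) (ι (ev s LinearMap.id (TensorProduct.comm k H H z))) := by
    intro w z
    induction z with
    | zero => simp [psi_zeroz]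
    | add x y hx hy => simp only [psi_add, map_add, add_mul, hx, hy, psi_addz]
    | tmul x y =>
      induction w with
      | zero => simp
      | add x y hx hy =>
        simp only [psi_add, mul_add, hx, hy]
      | tmul x' y' => simp [hs.mul, h.mi.mul, mul_assoc]
  have h3 := h1 R (Coalgebra.comul x)
  have h4 := h2 R (Coalgebra.comul x)
  rw [cv_apply, cv_apply] at h0
  rw [h0, h4] at h3
  have h5 : ev s LinearMap.id (TensorProduct.comm k H H (Coalgebra.comul x)) = eps k H H x :=
    LinearMap.congr_fun hs.s_id x
  rw [h5, eps_apply, Algebra.algebraMap_eq_smul_one, map_smul, h.mi.one, psi_smul] at h3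
  rw [cv_apply, lm_apply, eps_apply, Algebra.algebraMap_eq_smul_one]
  unfold phi
  rw [← h3]; simp

lemma phi_ι {ι : H →ₗ[k] A} {R : A ⊗[k] H} (h : IsYD ι R) (x : H) :
    phi s ι R * ι x = ι (s (s x)) * phi s ι R := by
  have h1 := phi_aux hs h
  have h2 : cv (ι ∘ₗ s ∘ₗ s) (ι ∘ₗ s) = eps k H A := by
    have := map_cv (h.mi.comp hs.mss) LinearMap.id (HopfAlgebra.antipode k)
    have h4 : cv LinearMap.id (HopfAlgebra.antipode k) = eps k H H := by
      ext x
      exact (HopfAlgebra.mul_antipode_lTensor_comul_apply (R := k) x)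
    rw [h4, map_eps (h.mi.comp hs.mss)] at this
    rw [this]
    congr 1
    ext x; simp [hs.h1]
  have h3 := congrArg (cv (ι ∘ₗ s ∘ₗ s)) h1
  rw [← cv_assoc, h2, eps_cv, ← cv_mid, cv_eps] at h3
  exact LinearMap.congr_fun h3 x

lemma phi_pow_ι {ι : H →ₗ[k] A} {R : A ⊗[k] H} (h : IsYD ι R) (n : ℕ) (x : H) :
    phi s ι R ^ n * ι x = ι (((s ∘ₗ s) ^ n : H →ₗ[k] H) x) * phi s ι R ^ n := by
  induction n generalizing x with
  | zero => simp
  | succ n ih =>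
    rw [pow_succ, mul_assoc, phi_ι hs h, ← mul_assoc, ih, mul_assoc, pow_succ]; rfl

lemma ss_s (n : ℕ) (x : H) : ((s ∘ₗ s) ^ n : H →ₗ[k] H) (s x) = s (((s ∘ₗ s) ^ n : H →ₗ[k] H) x) := by
  clear hs
  induction n generalizing x with
  | zero => simp
  | succ n ih => rw [pow_succ]; simp [ih]

lemma phi_pow {ι : H →ₗ[k] A} {R : A ⊗[k] H} (h : IsYD ι R) (n : ℕ) :
    phi s ι R ^ (n + 1) = psi R LinearMap.id (ι ∘ₗ s ∘ₗ expMap k H s (n + 1)) 1 := by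
  induction n with
  | zero => simp [expMap, phi]
  | succ n ih =>
    have e : expMap k H s (n + 1 + 1) = cv (expMap k H s (n + 1)) ((s ∘ₗ s) ^ (n + 1)) := rfl
    rw [e, hs.s_cv, map_cvop h.mi, ← h.psi_psi mlt_id, ← ih, pow_succ]
    have := psi_commute (c := phi s ι R ^ (n+1)) (F := ι ∘ₗ s) (F' := ι ∘ₗ s ∘ₗ (s ∘ₗ s)^(n+1))
      (fun a => by simp only [LinearMap.comp_apply]; rw [phi_pow_ι hs h, ss_s hs])
      R LinearMap.id 1
    rw [mul_one] at this
    exact this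

lemma IsYD.keyK {ι : H →ₗ[k] A} {R : A ⊗[k] H} (h : IsYD ι R) {j : A →ₗ[k] C} (hj : Mlt j)
    {f : H →ₗ[k] C} (hf : Mlt f) (hc : Cm j f) :
    psi R j (cv (j ∘ₗ ι) f ∘ₗ s) (ev j f R) = j (phi s ι R) := by
  have h1 : ev j f R = psi R j f 1 := by
    rw [ev_comm hc, psi]; congr 2; ext; simp
  have hT : Mlt (ev (j ∘ₗ ι) f) := (hj.comp h.mi).ev hf (hc.comp ι LinearMap.id)
  rw [h1, h.psi_psi hj]
  have h2 : cvop (cv (j ∘ₗ ι) f ∘ₗ s) f = j ∘ₗ ι ∘ₗ s := by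
    have := congrArg (fun g => ev (j ∘ₗ ι) f ∘ₗ g) hs.keyS
    simp only [map_cvop hT] at this
    rw [ev_iR _ _ (hj.comp h.mi), ← LinearMap.comp_assoc, ← LinearMap.comp_assoc, ev_iL _ _ hf] at this
    exact this
  rw [h2, phi, map_psi hj, hj.one]
  rfl
end Hopf

section Tens
variable {k H : Type u} [Field k] [Ring H] [HopfAlgebra k H]
  {A : Type u} [Ring A] [Algebra k A] {B : Type u} [Ring B] [Algebra k B]
  {C : Type u} [Ring C] [Algebra k C]

def tI (ιA : H →ₗ[k] A) (ιB : H →ₗ[k] B) : H →ₗ[k] A ⊗[k] B :=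
  cv (iL k A B ∘ₗ ιA) (iR k A B ∘ₗ ιB)

def tR (RA : A ⊗[k] H) (RB : B ⊗[k] H) : (A ⊗[k] B) ⊗[k] H :=
  ev (iL k (A ⊗[k] B) H ∘ₗ iR k A B) (iR k (A ⊗[k] B) H) RB *
  ev (iL k (A ⊗[k] B) H ∘ₗ iL k A B) (iR k (A ⊗[k] B) H) RA

lemma ev_tR (RA : A ⊗[k] H) (RB : B ⊗[k] H) {j : A ⊗[k] B →ₗ[k] C} {f : H →ₗ[k] C}
    (hj : Mlt j) (hf : Mlt f) (hc : Cm j f) :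
    ev j f (tR RA RB) = ev (j ∘ₗ iR k A B) f RB * ev (j ∘ₗ iL k A B) f RA := by
  have h := hj.ev hf hc
  rw [tR, h.mul, map_ev h, map_ev h, ← LinearMap.comp_assoc, ← LinearMap.comp_assoc,
    ev_iL _ _ hf, ev_iR _ _ hj]

lemma psi_tR (RA : A ⊗[k] H) (RB : B ⊗[k] H) {j : A ⊗[k] B →ₗ[k] C} {G : H →ₗ[k] C}
    (hj : Mlt j) (hG : ∀ x y, G (x * y) = G y * G x) (z : C) :
    psi (tR RA RB) j G z = psi RA (j ∘ₗ iL k A B) G (psi RB (j ∘ₗ iR k A B) G z) := by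
  unfold tR
  induction RB with
  | zero => simp [psi_zeroz]
  | add x y hx hy => simp only [psi_add, map_add, add_mul, hx, hy, psi_addz]
  | tmul x y =>
    induction RA with
    | zero => simp
    | add x y hx hy => simp only [psi_add, map_add, mul_add, hx, hy]
    | tmul x' y' =>
      have := hj.mul (1 ⊗ₜ x) (x' ⊗ₜ 1)
      simp only [Algebra.TensorProduct.tmul_mul_tmul, one_mul, mul_one] at this
      simp [hG, mul_assoc, this]

lemma mlt_tI {ιA : H →ₗ[k] A} {ιB : H →ₗ[k] B} (hA : Mlt ιA) (hB : Mlt ιB) : Mlt (tI ιA ιB) :=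
  (mlt_iL.comp hA).cv (mlt_iR.comp hB) (cm_i.comp _ _)

theorem IsYD.tens {ιA : H →ₗ[k] A} {RA : A ⊗[k] H} {ιB : H →ₗ[k] B} {RB : B ⊗[k] H}
    (hA : IsYD ιA RA) (hB : IsYD ιB RB) : IsYD (tI ιA ιB) (tR RA RB) := by
  refine ⟨mlt_tI hA.mi hB.mi, ?_, ?_, ?_⟩
  · intro C _ _ j f g hj hf hg hjf hjg hfg
    have hjc : Cm (j ∘ₗ iL k A B) (j ∘ₗ iR k A B) := fun x y => by
      simp only [LinearMap.comp_apply, ← hj.mul, cm_i x y]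
    rw [ev_tR _ _ hj hf hjf, ev_tR _ _ hj hg hjg, ev_tR _ _ hj (hf.cv hg hfg) (hjf.cv hjg),
      ← hA.hmul' (f := f) (hj.comp mlt_iL) (hjf.comp _ LinearMap.id),
      ← hB.hmul' (f := f) (hj.comp mlt_iR) (hjf.comp _ LinearMap.id)]
    have : ev (j ∘ₗ iL k A B) f RA * ev (j ∘ₗ iR k A B) g RB =
        ev (j ∘ₗ iR k A B) g RB * ev (j ∘ₗ iL k A B) f RA := by
      refine ev_commute (fun x => ?_) (fun x => ?_) _
      · exact (ev_commute (hjc.symm x) (fun y => hjf _ _) _).symm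
      · exact (ev_commute (F := j ∘ₗ iL k A B) (G := f) (fun y => (hjg _ _).symm) (fun y => (hfg _ _).symm) _).symm
    simp only [mul_assoc]
    rw [← mul_assoc (ev (j ∘ₗ iL k A B) f RA), this]
    simp only [mul_assoc]
  · intro C _ _ j f hj hf hjf h
    have hjc : Cm (j ∘ₗ iL k A B) (j ∘ₗ iR k A B) := fun x y => by
      simp only [LinearMap.comp_apply, ← hj.mul, cm_i x y]
    rw [ev_tR _ _ hj hf hjf, tI, map_cv hj, ← LinearMap.comp_assoc, ← LinearMap.comp_assoc]
    have yA := hA.hyd _ (j ∘ₗ iL k A B) f (hj.comp mlt_iL) hf (hjf.comp _ LinearMap.id)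
    have yB := hB.hyd _ (j ∘ₗ iR k A B) f (hj.comp mlt_iR) hf (hjf.comp _ LinearMap.id)
    have cA : ∀ x, ev (j ∘ₗ iL k A B) f RA * (j ∘ₗ iR k A B) x =
        (j ∘ₗ iR k A B) x * ev (j ∘ₗ iL k A B) f RA := fun x =>
      (ev_commute (hjc.symm x) (fun y => hjf _ _) _).symm
    have cB : ∀ x, ev (j ∘ₗ iR k A B) f RB * (j ∘ₗ iL k A B) x =
        (j ∘ₗ iL k A B) x * ev (j ∘ₗ iR k A B) f RB := fun x =>
      (ev_commute (hjc x) (fun y => hjf _ _) _).symm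
    generalize ev (j ∘ₗ iL k A B) f RA = TA at *
    generalize ev (j ∘ₗ iR k A B) f RB = TB at *
    generalize j ∘ₗ iL k A B = jA at *
    generalize j ∘ₗ iR k A B = jB at *
    have yA' : lm TA (cv f (jA ∘ₗ ιA)) = rm (cv (jA ∘ₗ ιA) f) TA := LinearMap.ext yA
    have yB' : lm TB (cv f (jB ∘ₗ ιB)) = rm (cv (jB ∘ₗ ιB) f) TB := LinearMap.ext yB
    have cA' : lm TA (jB ∘ₗ ιB) = rm (jB ∘ₗ ιB) TA := LinearMap.ext fun x => cA _
    have cB' : lm TB (jA ∘ₗ ιA) = rm (jA ∘ₗ ιA) TB := LinearMap.ext fun x => cB _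
    have e1 : lm TA (cv f (cv (jA ∘ₗ ιA) (jB ∘ₗ ιB))) =
        rm (cv (jA ∘ₗ ιA) (cv f (jB ∘ₗ ιB))) TA := by
      rw [← cv_assoc, ← cv_lm, yA', cv_mid, cA', cv_rm, cv_assoc]
    have e2 : lm TB (cv (jA ∘ₗ ιA) (cv f (jB ∘ₗ ιB))) =
        rm (cv (cv (jA ∘ₗ ιA) (jB ∘ₗ ιB)) f) TB := by
      rw [← cv_lm, cB', cv_mid, yB', cv_rm, cv_assoc]
    have e1 := LinearMap.congr_fun e1 h
    have e2 := LinearMap.congr_fun e2 h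
    simp only [lm_apply, rm_apply] at e1 e2
    rw [mul_assoc, e1, ← mul_assoc, e2, mul_assoc]
  · have hc : Cm (LinearMap.id : A ⊗[k] B →ₗ[k] _) (eps k H (A ⊗[k] B)) := fun x y => by
      simp only [eps_apply, Algebra.commutes]
    rw [ev_tR _ _ mlt_id mlt_eps hc, hA.hone' (mlt_id.comp mlt_iL), hB.hone' (mlt_id.comp mlt_iR),
      one_mul]

lemma ybe {ιA : H →ₗ[k] A} {RA : A ⊗[k] H} {ιB : H →ₗ[k] B} {RB : B ⊗[k] H}
    (hA : IsYD ιA RA) (hB : IsYD ιB RB) {jA : A →ₗ[k] C} {jB : B →ₗ[k] C} {f : H →ₗ[k] C}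
    (hjA : Mlt jA) (hjB : Mlt jB) (hf : Mlt f) (hAB : Cm jA jB) (hAf : Cm jA f) (hBf : Cm jB f) :
    ev jA f RA * (ev jB f RB * ev jB (jA ∘ₗ ιA) RB) =
      ev jB (jA ∘ₗ ιA) RB * (ev jB f RB * ev jA f RA) := by
  have yA : lm (ev jA f RA) (cv f (jA ∘ₗ ιA)) = rm (cv (jA ∘ₗ ιA) f) (ev jA f RA) :=
    LinearMap.ext (hA.hyd _ jA f hjA hf hAf)
  have cA : lm (ev jA f RA) jB = rm jB (ev jA f RA) := LinearMap.ext fun x =>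
      (ev_commute (hAB.symm x) (fun y => hBf _ _) _).symm
  rw [hB.hmul' hjB hBf, ← mul_assoc, hB.hmul' hjB (hAB.symm.comp LinearMap.id ιA),
    ← lm_apply, ← ev_lm, cA, ev_mid, yA, ev_rm]
  rfl

variable {s : H →ₗ[k] H} (hs : IsInv s)
  {ιA : H →ₗ[k] A} {RA : A ⊗[k] H} {ιB : H →ₗ[k] B} {RB : B ⊗[k] H}
    (hA : IsYD ιA RA) (hB : IsYD ιB RB)

def sig (RA : A ⊗[k] H) (ιB : H →ₗ[k] B) : A ⊗[k] B := ev (iL k A B) (iR k A B ∘ₗ ιB) RA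
def rho (ιA : H →ₗ[k] A) (RB : B ⊗[k] H) : A ⊗[k] B := ev (iR k A B) (iL k A B ∘ₗ ιA) RB
def mono (ιA : H →ₗ[k] A) (RA : A ⊗[k] H) (ιB : H →ₗ[k] B) (RB : B ⊗[k] H) : A ⊗[k] B :=
  sig RA ιB * rho ιA RB

include hA hB
lemma sig_ι (h : H) : sig RA ιB * cv (iR k A B ∘ₗ ιB) (iL k A B ∘ₗ ιA) h =
    tI ιA ιB h * sig RA ιB :=
  hA.hyd _ (iL k A B) (iR k A B ∘ₗ ιB) mlt_iL (mlt_iR.comp hB.mi) (cm_i.comp LinearMap.id ιB) h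
lemma rho_ι (h : H) : rho ιA RB * tI ιA ιB h =
    cv (iR k A B ∘ₗ ιB) (iL k A B ∘ₗ ιA) h * rho ιA RB :=
  hB.hyd _ (iR k A B) (iL k A B ∘ₗ ιA) mlt_iR (mlt_iL.comp hA.mi) (cm_i.symm.comp LinearMap.id ιA) h
lemma mono_ι (h : H) : mono ιA RA ιB RB * tI ιA ιB h = tI ιA ιB h * mono ιA RA ιB RB := by
  rw [mono, mul_assoc, rho_ι hA hB, ← mul_assoc, sig_ι hA hB, mul_assoc]

lemma mono_R : iL k (A ⊗[k] B) H (mono ιA RA ιB RB) * tR RA RB =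
    tR RA RB * iL k (A ⊗[k] B) H (mono ιA RA ιB RB) := by
  have hjA : Mlt (iL k (A ⊗[k] B) H ∘ₗ iL k A B) := mlt_iL.comp mlt_iL
  have hjB : Mlt (iL k (A ⊗[k] B) H ∘ₗ iR k A B) := mlt_iL.comp mlt_iR
  have hAB : Cm (iL k (A ⊗[k] B) H ∘ₗ iL k A B) (iL k (A ⊗[k] B) H ∘ₗ iR k A B) :=
    fun x y => by simp
  have hAf : Cm (iL k (A ⊗[k] B) H ∘ₗ iL k A B) (iR k (A ⊗[k] B) H) := cm_i.comp _ LinearMap.id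
  have hBf : Cm (iL k (A ⊗[k] B) H ∘ₗ iR k A B) (iR k (A ⊗[k] B) H) := cm_i.comp _ LinearMap.id
  have y1 := ybe hA hB hjA hjB mlt_iR hAB hAf hBf
  have y2 := ybe hB hA hjB hjA mlt_iR hAB.symm hBf hAf
  rw [mono, mlt_iL.mul, sig, rho, map_ev mlt_iL, map_ev mlt_iL, ← LinearMap.comp_assoc,
    ← LinearMap.comp_assoc, tR]
  rw [mul_assoc, ← y1]
  simp only [← mul_assoc] at y2 ⊢
  rw [← y2]

include hs
lemma phi_tens : phi s (tI ιA ιB) (tR RA RB) =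
    psi RA (iL k A B) (tI ιA ιB ∘ₗ s) (psi RB (iR k A B) (tI ιA ιB ∘ₗ s) 1) := by
  rw [phi, psi_tR _ _ mlt_id]
  · rfl
  · intro x y; simp [hs.mul, (mlt_tI hA.mi hB.mi).mul]

lemma mono_phi : mono ιA RA ιB RB * phi s (tI ιA ιB) (tR RA RB) =
    iL k A B (phi s ιA RA) * iR k A B (phi s ιB RB) := by
  rw [phi_tens hs hA hB, psi_commute (F' := tI ιA ιB ∘ₗ s) (fun a => mono_ι hA hB _), mono,
    mul_assoc, psi_commute (F' := cv (iR k A B ∘ₗ ιB) (iL k A B ∘ₗ ιA) ∘ₗ s)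
      (fun a => rho_ι hA hB _), mul_one, rho,
    hB.keyK hs mlt_iR (mlt_iL.comp hA.mi) (cm_i.symm.comp LinearMap.id ιA), psi_right
      (j := iL k A B) (fun d => (cm_i _ _).symm)]
  congr 1
  exact hA.keyK hs mlt_iL (mlt_iR.comp hB.mi) (cm_i.comp LinearMap.id ιB)

lemma mono_phi_comm : mono ιA RA ιB RB * phi s (tI ιA ιB) (tR RA RB) =
    phi s (tI ιA ιB) (tR RA RB) * mono ιA RA ιB RB := by
  have h := congrArg (fun w => psi w LinearMap.id (tI ιA ιB ∘ₗ s) 1) (mono_R hA hB)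
  have hm := mono_ι hA hB
  generalize mono ιA RA ιB RB = m at *
  unfold phi
  generalize tR RA RB = w at *
  have h1 : ∀ w, psi (iL k (A ⊗[k] B) H m * w) LinearMap.id (tI ιA ιB ∘ₗ s) 1 =
      m * psi w LinearMap.id (tI ιA ιB ∘ₗ s) 1 := by
    intro w
    induction w with
    | zero => simp
    | add x y hx hy => simp only [mul_add, psi_add, hx, hy]
    | tmul x y => simp [← mul_assoc, hm]
  have h2 : ∀ w, psi (w * iL k (A ⊗[k] B) H m) LinearMap.id (tI ιA ιB ∘ₗ s) 1 =
      psi w LinearMap.id (tI ιA ιB ∘ₗ s) 1 * m := by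
    intro w
    induction w with
    | zero => simp
    | add x y hx hy => simp only [add_mul, psi_add, hx, hy]
    | tmul x y => simp [mul_assoc]
  rw [← h1, h, h2]

lemma mono_pow (n : ℕ) : mono ιA RA ιB RB ^ n * phi s (tI ιA ιB) (tR RA RB) ^ n =
    (phi s ιA RA ^ n) ⊗ₜ (phi s ιB RB ^ n) := by
  have hc : Commute (mono ιA RA ιB RB) (phi s (tI ιA ιB) (tR RA RB)) := mono_phi_comm hs hA hB
  rw [← hc.mul_pow, mono_phi hs hA hB]
  simp [Algebra.TensorProduct.tmul_pow]
end Tens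

section Twist
variable {k H H' : Type u} [Field k] [Ring H] [HopfAlgebra k H] [Ring H'] [HopfAlgebra k H']
  {A : Type u} [Ring A] [Algebra k A] {B : Type u} [Ring B] [Algebra k B]
  {C : Type u} [Ring C] [Algebra k C]

structure Tw (f : H ≃ₐ[k] H') (J Ji : H ⊗[k] H) : Prop where
  h1 : J * Ji = 1
  h2 : Ji * J = 1
  coc : ∀ (C : Type u) [Ring C] [Algebra k C] (P Q S : H →ₗ[k] C), Mlt P → Mlt Q → Mlt S →
    Cm P Q → Cm P S → Cm Q S →
    ev (cv P Q) S J * ev P Q J = ev P (cv Q S) J * ev Q S J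
  cu1 : ev (eps k H H) LinearMap.id J = 1
  cu2 : ev LinearMap.id (eps k H H) J = 1
  hε : ∀ x : H, Coalgebra.counit (R := k) (f x) = Coalgebra.counit (R := k) x
  hΔ : ∀ x : H, Coalgebra.comul (R := k) (f x)
      = TensorProduct.map f.toLinearMap f.toLinearMap (Ji * Coalgebra.comul (R := k) x * J)

variable {f : H ≃ₐ[k] H'} {J Ji : H ⊗[k] H} (t : Tw f J Ji)
include t

lemma Tw.inv1 {F G : H →ₗ[k] C} (hF : Mlt F) (hG : Mlt G) (hc : Cm F G) :
    ev F G J * ev F G Ji = 1 := by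
  have h := hF.ev hG hc
  rw [← h.mul, t.h1, h.one]
lemma Tw.inv2 {F G : H →ₗ[k] C} (hF : Mlt F) (hG : Mlt G) (hc : Cm F G) :
    ev F G Ji * ev F G J = 1 := by
  have h := hF.ev hG hc
  rw [← h.mul, t.h2, h.one]

lemma Tw.eps1 {F : H →ₗ[k] C} (hF : Mlt F) : ev (eps k H C) F J = 1 := by
  have := congrArg F t.cu1
  rwa [map_ev hF, hF.one, map_eps hF] at this
lemma Tw.eps2 {F : H →ₗ[k] C} (hF : Mlt F) : ev F (eps k H C) J = 1 := by
  have := congrArg F t.cu2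
  rwa [map_ev hF, hF.one, map_eps hF] at this

omit t in
lemma cm_eps (F : H →ₗ[k] C) : Cm F (eps k H C) := fun x y => by
  simp only [eps_apply, Algebra.commutes]

lemma Tw.eps2i {F : H →ₗ[k] C} (hF : Mlt F) : ev F (eps k H C) Ji = 1 := by
  have := t.inv2 hF mlt_eps (cm_eps F)
  rwa [t.eps2 hF, mul_one] at this
lemma Tw.eps1i {F : H →ₗ[k] C} (hF : Mlt F) : ev (eps k H C) F Ji = 1 := by
  have := t.inv2 mlt_eps hF (cm_eps F).symm
  rwa [t.eps1 hF, mul_one] at this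

omit t in
lemma mltE (g : H ≃ₐ[k] H') : Mlt g.toLinearMap := ⟨map_one g, map_mul g⟩

lemma Tw.cv' {F G : H' →ₗ[k] C} (hF : Mlt F) (hG : Mlt G) (hc : Cm F G) :
    cv F G ∘ₗ f.toLinearMap = lm (ev (F ∘ₗ f.toLinearMap) (G ∘ₗ f.toLinearMap) Ji)
      (rm (cv (F ∘ₗ f.toLinearMap) (G ∘ₗ f.toLinearMap))
        (ev (F ∘ₗ f.toLinearMap) (G ∘ₗ f.toLinearMap) J)) := by
  ext x
  have h := (hF.comp (mltE f)).ev (hG.comp (mltE f)) (hc.comp _ _)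
  simp only [lm_apply, rm_apply, LinearMap.comp_apply, cv_apply]
  rw [AlgEquiv.toLinearMap_apply, t.hΔ, ev_map, h.mul, h.mul, mul_assoc]

def tw (f : H ≃ₐ[k] H') (J Ji : H ⊗[k] H) (ι : H →ₗ[k] A) (R : A ⊗[k] H) : A ⊗[k] H' :=
  ev (iL k A H' ∘ₗ ι) (iR k A H' ∘ₗ f.toLinearMap) Ji *
  ev (iL k A H') (iR k A H' ∘ₗ f.toLinearMap) R *
  ev (iR k A H' ∘ₗ f.toLinearMap) (iL k A H' ∘ₗ ι) J

omit t in
lemma ev_tw (ι : H →ₗ[k] A) (R : A ⊗[k] H) {j : A →ₗ[k] C} {g : H' →ₗ[k] C}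
    (hj : Mlt j) (hg : Mlt g) (hc : Cm j g) :
    ev j g (tw f J Ji ι R) = ev (j ∘ₗ ι) (g ∘ₗ f.toLinearMap) Ji *
      ev j (g ∘ₗ f.toLinearMap) R * ev (g ∘ₗ f.toLinearMap) (j ∘ₗ ι) J := by
  have h := hj.ev hg hc
  simp only [tw, h.mul, map_ev h, ← LinearMap.comp_assoc, ev_iL _ _ hg, ev_iR _ _ hj]

omit t in
lemma ev_conj_r {P Q : Type u} [AddCommGroup P] [Module k P] [AddCommGroup Q] [Module k Q]
    {F : P →ₗ[k] C} {G : Q →ₗ[k] C} {c c' : C} (h : ∀ x, c * F x = F x * c) (z : P ⊗[k] Q) :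
    ev F (lm c (rm G c')) z = c * ev F G z * c' := by
  have : lm c F = rm F c := LinearMap.ext h
  rw [← ev_mid, ← this, ev_lm, ev_rm, lm_apply, rm_apply, mul_assoc]
omit t in
lemma ev_conj_l {P Q : Type u} [AddCommGroup P] [Module k P] [AddCommGroup Q] [Module k Q]
    {F : P →ₗ[k] C} {G : Q →ₗ[k] C} {c c' : C} (h : ∀ x, c' * G x = G x * c') (z : P ⊗[k] Q) :
    ev (lm c (rm F c')) G z = c * ev F G z * c' := by
  have : lm c' G = rm G c' := LinearMap.ext h
  rw [ev_lm, ev_mid, this, ev_rm, lm_apply, rm_apply, mul_assoc]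

theorem IsYD.twist {ι : H →ₗ[k] A} {R : A ⊗[k] H} (h : IsYD ι R) :
    IsYD (ι ∘ₗ f.symm.toLinearMap) (tw f J Ji ι R) := by
  have ff : (ι ∘ₗ f.symm.toLinearMap) ∘ₗ f.toLinearMap = ι := by ext; simp
  refine ⟨h.mi.comp (mltE f.symm), ?_, ?_, ?_⟩
  · intro C _ _ j f' g' hj hf' hg' hjf' hjg' hfg'
    rw [ev_tw _ _ hj hf' hjf', ev_tw _ _ hj hg' hjg', ev_tw _ _ hj (hf'.cv hg' hfg') (hjf'.cv hjg'),
      t.cv' hf' hg' hfg']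
    have hF : Mlt (f' ∘ₗ f.toLinearMap) := hf'.comp (mltE f)
    have hG : Mlt (g' ∘ₗ f.toLinearMap) := hg'.comp (mltE f)
    have jF : Cm j (f' ∘ₗ f.toLinearMap) := hjf'.comp LinearMap.id _
    have jG : Cm j (g' ∘ₗ f.toLinearMap) := hjg'.comp LinearMap.id _
    have FG : Cm (f' ∘ₗ f.toLinearMap) (g' ∘ₗ f.toLinearMap) := hfg'.comp _ _
    generalize f' ∘ₗ f.toLinearMap = F at *
    generalize g' ∘ₗ f.toLinearMap = G at *
    have hp : Mlt (j ∘ₗ ι) := hj.comp h.mi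
    have pF : Cm (j ∘ₗ ι) F := jF.comp ι LinearMap.id
    have pG : Cm (j ∘ₗ ι) G := jG.comp ι LinearMap.id
    have cj : ∀ z x, ev F G z * j x = j x * ev F G z := fun z x =>
      (ev_commute (jF x) (jG x) z).symm
    rw [ev_conj_r (F := j ∘ₗ ι) (fun x => cj _ _), ev_conj_r (F := j) (fun x => cj _ _),
      ev_conj_l (G := j ∘ₗ ι) (fun x => cj _ _),
      ← h.hmul' hj jF]
    have yF : lm (ev j F R) (cv F (j ∘ₗ ι)) = rm (cv (j ∘ₗ ι) F) (ev j F R) :=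
      LinearMap.ext (h.hyd _ j F hj hF jF)
    have yG : lm (ev j G R) (cv G (j ∘ₗ ι)) = rm (cv (j ∘ₗ ι) G) (ev j G R) :=
      LinearMap.ext (h.hyd _ j G hj hG jG)
    have cF : lm (ev j F R) G = rm G (ev j F R) := LinearMap.ext fun x =>
      (ev_commute (fun y => (jG y x).symm) (fun y => (FG y x).symm) _).symm
    have cG : lm (ev j G R) F = rm F (ev j G R) := LinearMap.ext fun x =>
      (ev_commute (fun y => (jF y x).symm) (FG x) _).symm
    have e1 : ev j G R * ev F (cv G (j ∘ₗ ι)) J = ev F (cv (j ∘ₗ ι) G) J * ev j G R := by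
      rw [← lm_apply, ← ev_lm, cG, ev_mid, yG, ev_rm]; rfl
    have e2 : ev j F R * ev (cv F (j ∘ₗ ι)) G J = ev (cv (j ∘ₗ ι) F) G J * ev j F R := by
      rw [← lm_apply, ← ev_lm, yF, ev_mid, cF, ev_rm]; rfl
    have c1 := t.coc _ F G (j ∘ₗ ι) hF hG hp FG pF.symm pG.symm
    have c2 := t.coc _ (j ∘ₗ ι) F G hp hF hG pF pG FG
    have c3 := t.coc _ F (j ∘ₗ ι) G hF hp hG pF.symm FG pG
    have i1 := t.inv1 hF hG FG
    have i2 := t.inv2 hF hG FG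
    have i3 := t.inv1 hp (hF.cv hG FG) (pF.cv pG)
    have i4 := t.inv2 hp (hF.cv hG FG) (pF.cv pG)
    have i5 := t.inv1 hp hF pF
    have i6 := t.inv2 hp hF pF
    have i7 := t.inv1 hp hG pG
    have i8 := t.inv2 hp hG pG
    have i9 := t.inv1 (hp.cv hF pF) hG (pG.symm.cv FG.symm).symm
    have i10 := t.inv2 (hp.cv hF pF) hG (pG.symm.cv FG.symm).symm
    have i11 := t.inv1 (hF.cv hp pF.symm) hG (FG.symm.cv pG.symm).symm
    have i12 := t.inv2 (hF.cv hp pF.symm) hG (FG.symm.cv pG.symm).symm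
    generalize ev F (cv G (j ∘ₗ ι)) J = x1 at *
    generalize ev F (cv (j ∘ₗ ι) G) J = x2 at *
    generalize ev (cv F (j ∘ₗ ι)) G J = x3 at *
    generalize ev (cv (j ∘ₗ ι) F) G J = x4 at *
    generalize ev (j ∘ₗ ι) (cv F G) J = x5 at *
    generalize ev (cv F G) (j ∘ₗ ι) J = x6 at *
    generalize ev (cv F (j ∘ₗ ι)) G Ji = y3 at *
    generalize ev (cv (j ∘ₗ ι) F) G Ji = y4 at *
    generalize ev (j ∘ₗ ι) (cv F G) Ji = y5 at *
    generalize ev F G J = a at *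
    generalize ev F G Ji = ai at *
    generalize ev (j ∘ₗ ι) F J = b at *
    generalize ev (j ∘ₗ ι) F Ji = bi at *
    generalize ev (j ∘ₗ ι) G J = c at *
    generalize ev (j ∘ₗ ι) G Ji = ci at *
    generalize ev F (j ∘ₗ ι) J = d at *
    generalize ev G (j ∘ₗ ι) J = e at *
    generalize ev j F R = TF at *
    generalize ev j G R = TG at *
    have k1 : ai * y5 = bi * y4 := by
      calc ai * y5 = ai * y5 * (x4 * b * bi * y4) := by
            rw [mul_assoc x4, i5, mul_one, i9, mul_one]
        _ = ai * (y5 * x5) * a * bi * y4 := by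
            rw [c2]; simp only [mul_assoc]
        _ = bi * y4 := by rw [i4, mul_one, i2, one_mul]
    have k2 : y4 * TF = TF * y3 := by
      calc y4 * TF = y4 * (TF * x3) * y3 := by rw [mul_assoc, mul_assoc, i11, mul_one]
        _ = (y4 * x4) * TF * y3 := by rw [e2]; simp only [mul_assoc]
        _ = TF * y3 := by rw [i10, one_mul]
    have k3 : y3 * x2 = d * ci := by
      calc y3 * x2 = y3 * (x2 * c) * ci := by rw [mul_assoc, mul_assoc, i7, mul_one]
        _ = (y3 * x3) * d * ci := by rw [← c3]; simp only [mul_assoc]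
        _ = d * ci := by rw [i12, one_mul]
    symm
    calc ai * y5 * a * (ai * (TF * TG) * a) * (ai * x6 * a)
        = ai * y5 * (a * ai) * (TF * TG) * (a * ai) * (x6 * a) := by simp only [mul_assoc]
      _ = bi * (y4 * TF) * (TG * x1) * e := by
          rw [i1, mul_one, mul_one, c1, k1]; simp only [mul_assoc]
      _ = bi * TF * (y3 * x2) * TG * e := by rw [k2, e1]; simp only [mul_assoc]
      _ = bi * TF * d * (ci * TG * e) := by rw [k3]; simp only [mul_assoc]
  · intro C _ _ j g hj hg hjg y
    obtain ⟨x, rfl⟩ := f.surjective y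
    rw [ev_tw _ _ hj hg hjg]
    have hp : Mlt (j ∘ₗ ι ∘ₗ f.symm.toLinearMap) := hj.comp (h.mi.comp (mltE f.symm))
    have pg : Cm (j ∘ₗ ι ∘ₗ f.symm.toLinearMap) g := hjg.comp _ LinearMap.id
    have fj : (j ∘ₗ ι ∘ₗ f.symm.toLinearMap) ∘ₗ f.toLinearMap = j ∘ₗ ι := by
      rw [LinearMap.comp_assoc, ff]
    have e1 := LinearMap.congr_fun (t.cv' hg hp pg.symm) x
    have e2 := LinearMap.congr_fun (t.cv' hp hg pg) x
    rw [fj] at e1 e2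
    refine (congrArg _ e1).trans (Eq.trans ?_ (congrArg (· * _) e2).symm)
    simp only [lm_apply, rm_apply]
    have hF := hg.comp (mltE f)
    have jF : Cm j (g ∘ₗ f.toLinearMap) := hjg.comp LinearMap.id _
    generalize g ∘ₗ f.toLinearMap = F at *
    have hq := hj.comp h.mi
    have qF : Cm (j ∘ₗ ι) F := jF.comp ι LinearMap.id
    have y1 := h.hyd _ j F hj hF jF x
    have i1 := t.inv1 hF hq qF.symm
    have i2 := t.inv1 hq hF qF
    generalize ev (j ∘ₗ ι) F Ji = ai at *
    generalize ev (j ∘ₗ ι) F J = a at *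
    generalize ev F (j ∘ₗ ι) Ji = bi at *
    generalize ev F (j ∘ₗ ι) J = b at *
    generalize ev j F R = T at *
    generalize cv F (j ∘ₗ ι) x = u at *
    generalize cv (j ∘ₗ ι) F x = v at *
    calc ai * T * b * (bi * (u * b)) = ai * T * (b * bi) * (u * b) := by simp only [mul_assoc]
      _ = ai * (T * u) * b := by rw [i1]; simp only [mul_assoc, one_mul]
      _ = ai * (v * (a * ai) * T) * b := by rw [i2, y1, mul_one]
      _ = _ := by simp only [mul_assoc]
  · have e : eps k H' A ∘ₗ f.toLinearMap = eps k H A := by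
      ext x; simp [eps_apply, t.hε]
    rw [ev_tw _ _ mlt_id mlt_eps (fun x y => by simp only [eps_apply, Algebra.commutes]), e,
      h.hone, LinearMap.id_comp, t.eps1 h.mi, t.eps2i h.mi, one_mul, one_mul]

lemma Tw.mono {ιA : H →ₗ[k] A} {RA : A ⊗[k] H} {ιB : H →ₗ[k] B} {RB : B ⊗[k] H}
    (hA : Mlt ιA) (hB : Mlt ιB) :
    mono (ιA ∘ₗ f.symm.toLinearMap) (tw f J Ji ιA RA) (ιB ∘ₗ f.symm.toLinearMap)
      (tw f J Ji ιB RB) =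
    ev (iL k A B ∘ₗ ιA) (iR k A B ∘ₗ ιB) Ji * mono ιA RA ιB RB *
      ev (iL k A B ∘ₗ ιA) (iR k A B ∘ₗ ιB) J := by
  have f1 : (iL k A B ∘ₗ ιA ∘ₗ f.symm.toLinearMap) ∘ₗ f.toLinearMap = iL k A B ∘ₗ ιA := by
    ext; simp
  have f2 : (iR k A B ∘ₗ ιB ∘ₗ f.symm.toLinearMap) ∘ₗ f.toLinearMap = iR k A B ∘ₗ ιB := by
    ext; simp
  unfold HT.mono sig rho
  rw [ev_tw _ _ mlt_iL (mlt_iR.comp (hB.comp (mltE f.symm))) (cm_i.comp LinearMap.id _),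
    ev_tw _ _ mlt_iR (mlt_iL.comp (hA.comp (mltE f.symm))) (cm_i.symm.comp LinearMap.id _),
    f1, f2]
  have := t.inv1 (mlt_iR.comp hB) (mlt_iL.comp hA) (cm_i.symm.comp ιB ιA)
  simp only [mul_assoc]
  rw [← mul_assoc (ev (iR k A B ∘ₗ ιB) (iL k A B ∘ₗ ιA) J), this, one_mul]

lemma Tw.mono_pow {ιA : H →ₗ[k] A} {RA : A ⊗[k] H} {ιB : H →ₗ[k] B} {RB : B ⊗[k] H}
    (hA : Mlt ιA) (hB : Mlt ιB) (n : ℕ)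
    (h : HT.mono (ιA ∘ₗ f.symm.toLinearMap) (tw f J Ji ιA RA) (ιB ∘ₗ f.symm.toLinearMap)
      (tw f J Ji ιB RB) ^ n = 1) : HT.mono ιA RA ιB RB ^ n = 1 := by
  rw [t.mono hA hB] at h
  have i1 := t.inv1 (mlt_iL.comp hA) (mlt_iR.comp hB) (cm_i.comp ιA ιB)
  have i2 := t.inv2 (mlt_iL.comp hA) (mlt_iR.comp hB) (cm_i.comp ιA ιB)
  generalize ev (iL k A B ∘ₗ ιA) (iR k A B ∘ₗ ιB) Ji = ci at *
  generalize ev (iL k A B ∘ₗ ιA) (iR k A B ∘ₗ ιB) J = c at *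
  generalize HT.mono ιA RA ιB RB = m at *
  have : ∀ n, (ci * m * c) ^ n = ci * m ^ n * c := by
    intro n
    induction n with
    | zero => simp [i2]
    | succ n ih =>
      rw [pow_succ, ih]
      calc ci * m ^ n * c * (ci * m * c) = ci * m ^ n * (c * ci) * m * c := by
            simp only [mul_assoc]
        _ = _ := by rw [i1, pow_succ]; simp only [mul_assoc, one_mul]
  rw [this] at h
  calc m ^ n = (c * ci) * m ^ n * (c * ci) := by rw [i1]; simp
    _ = c * (ci * m ^ n * c) * ci := by simp only [mul_assoc]
    _ = 1 := by rw [h, mul_one, i1]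

theorem Tw.swap : Tw f.symm (TensorProduct.map f.toLinearMap f.toLinearMap Ji)
    (TensorProduct.map f.toLinearMap f.toLinearMap J) := by
  have hm : Mlt (TensorProduct.map f.toLinearMap f.toLinearMap) :=
    Mlt.ofAlgHom (Algebra.TensorProduct.map f.toAlgHom f.toAlgHom)
  have e1 : eps k H' H' ∘ₗ f.toLinearMap = eps k H H' := by
      ext x; simp [eps_apply, t.hε]
  refine ⟨?_, ?_, ?_, ?_, ?_, ?_, ?_⟩
  · rw [← hm.mul, t.h2, hm.one]
  · rw [← hm.mul, t.h1, hm.one]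
  · intro C _ _ P Q S hP hQ hS hPQ hPS hQS
    simp only [ev_map]
    rw [t.cv' hP hQ hPQ, t.cv' hQ hS hQS]
    have hp := hP.comp (mltE f)
    have hq := hQ.comp (mltE f)
    have hs := hS.comp (mltE f)
    have pq : Cm (P ∘ₗ f.toLinearMap) (Q ∘ₗ f.toLinearMap) := hPQ.comp _ _
    have ps : Cm (P ∘ₗ f.toLinearMap) (S ∘ₗ f.toLinearMap) := hPS.comp _ _
    have qs : Cm (Q ∘ₗ f.toLinearMap) (S ∘ₗ f.toLinearMap) := hQS.comp _ _
    generalize P ∘ₗ f.toLinearMap = p at *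
    generalize Q ∘ₗ f.toLinearMap = q at *
    generalize S ∘ₗ f.toLinearMap = s at *
    rw [ev_conj_l (fun x => (ev_commute (ps.symm x) (qs.symm x) _).symm),
      ev_conj_r (fun x => (ev_commute (pq x) (ps x) _).symm)]
    have c := t.coc _ p q s hp hq hs pq ps qs
    have i1 := t.inv1 hp hq pq
    have i2 := t.inv2 hp hq pq
    have i3 := t.inv1 hq hs qs
    have i4 := t.inv1 hp (hq.cv hs qs) (pq.cv ps)
    have i5 := t.inv2 (hp.cv hq pq) hs (ps.symm.cv qs.symm).symm
    generalize ev p q J = a at *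
    generalize ev p q Ji = ai at *
    generalize ev q s J = b at *
    generalize ev q s Ji = bi at *
    generalize ev (cv p q) s J = x at *
    generalize ev (cv p q) s Ji = xi at *
    generalize ev p (cv q s) J = y at *
    generalize ev p (cv q s) Ji = yi at *
    calc ai * xi * a * ai = ai * xi := by rw [mul_assoc, i1, mul_one]
      _ = ai * xi * (y * (b * bi) * yi) := by rw [i3, mul_one, i4, mul_one]
      _ = ai * xi * (y * b) * (bi * yi) := by simp only [mul_assoc]
      _ = ai * (xi * x) * a * (bi * yi) := by rw [← c]; simp only [mul_assoc]
      _ = bi * yi := by rw [i5, mul_one, i2, one_mul]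
      _ = bi * yi * b * bi := by rw [mul_assoc _ b, i3, mul_one]
  · rw [ev_map, e1, LinearMap.id_comp, t.eps1i (mltE f)]
  · rw [ev_map, e1, LinearMap.id_comp, t.eps2i (mltE f)]
  · intro y
    obtain ⟨x, rfl⟩ := f.surjective y
    rw [t.hε, f.symm_apply_apply]
  · intro y
    obtain ⟨x, rfl⟩ := f.surjective y
    rw [t.hΔ, f.symm_apply_apply, ← hm.mul, ← hm.mul]
    have : J * (Ji * Coalgebra.comul x * J) * Ji = Coalgebra.comul x := by
      calc J * (Ji * Coalgebra.comul x * J) * Ji = (J * Ji) * Coalgebra.comul x * (J * Ji) := by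
            simp only [mul_assoc]
        _ = _ := by rw [t.h1, one_mul, mul_one]
    rw [this]
    generalize (Coalgebra.comul x : H ⊗[k] H) = z
    induction z with
    | zero => simp
    | add x y hx hy => rw [map_add, map_add, ← hx, ← hy]
    | tmul x y => simp

omit t in
lemma coc_of (hJcocycle : TensorProduct.map (Coalgebra.comul (R := k)) LinearMap.id J * (J ⊗ₜ[k] (1 : H))
      = (TensorProduct.assoc k H H H).symm
          (TensorProduct.map LinearMap.id (Coalgebra.comul (R := k)) J)
        * (TensorProduct.assoc k H H H).symm ((1 : H) ⊗ₜ[k] J))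
    (P Q S : H →ₗ[k] C) (hP : Mlt P) (hQ : Mlt Q) (hS : Mlt S) (hPQ : Cm P Q) (hPS : Cm P S)
    (hQS : Cm Q S) : ev (cv P Q) S J * ev P Q J = ev P (cv Q S) J * ev Q S J := by
  have hE := (hP.ev hQ hPQ).ev hS (hPS.symm.ev hQS.symm).symm
  have h := congrArg (ev (ev P Q) S) hJcocycle
  have ha : ∀ z, ev (ev P Q) S ((TensorProduct.assoc k H H H).symm z) = ev P (ev Q S) z := by
    intro z
    induction z with
    | zero => simp
    | add x y hx hy => simp only [map_add, hx, hy]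
    | tmul x y =>
      induction y with
      | zero => simp
      | add x y hx hy => simp only [map_add, TensorProduct.tmul_add, hx, hy]
      | tmul y z => simp [mul_assoc]
  rw [hE.mul, hE.mul, ha, ha, ev_map, ev_map, ev_tmul, ev_tmul, hS.one, hP.one, one_mul, mul_one]
    at h
  exact h

end Twist

section Mk
variable {k H : Type u} [Field k] [Ring H] [HopfAlgebra k H]
  {A : Type u} [Ring A] [Algebra k A]

lemma mkYD {ι : H →ₗ[k] A} {R : A ⊗[k] H} (mi : Mlt ι)
    (hm : ev (iL k A (H ⊗[k] H)) (iR k A (H ⊗[k] H) ∘ₗ iL k H H) R *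
      ev (iL k A (H ⊗[k] H)) (iR k A (H ⊗[k] H) ∘ₗ iR k H H) R =
      ev (iL k A (H ⊗[k] H)) (iR k A (H ⊗[k] H) ∘ₗ cv (iL k H H) (iR k H H)) R)
    (hy : ∀ h, R * cv (iR k A H) (iL k A H ∘ₗ ι) h = cv (iL k A H ∘ₗ ι) (iR k A H) h * R)
    (ho : ev (iL k A k) (iR k A k ∘ₗ Coalgebra.counit) R = 1) : IsYD ι R := by
  refine ⟨mi, ?_, ?_, ?_⟩
  · intro C _ _ j f g hj hf hg hjf hjg hfg
    have h1 := hf.ev hg hfg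
    have h := hj.ev h1 (hjf.ev hjg)
    have := congrArg (ev j (ev f g)) hm
    simp only [h.mul, map_ev h, ← LinearMap.comp_assoc, ev_iL _ _ h1, ev_iR _ _ hj,
      ev_iL _ _ hg, ev_iR _ _ hf, map_cv h1] at this
    exact this
  · intro C _ _ j f hj hf hjf x
    have h := hj.ev hf hjf
    have := congrArg (ev j f) (hy x)
    rw [h.mul, h.mul] at this
    have e1 := LinearMap.congr_fun (map_cv h (iR k A H) (iL k A H ∘ₗ ι)) x
    have e2 := LinearMap.congr_fun (map_cv h (iL k A H ∘ₗ ι) (iR k A H)) x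
    rw [← LinearMap.comp_assoc, ev_iL _ _ hf, ev_iR _ _ hj] at e1 e2
    rw [← e1, ← e2]
    exact this
  · have h1 : Mlt (Algebra.linearMap k A) := Mlt.ofAlgHom (Algebra.ofId k A)
    have h : Mlt (ev LinearMap.id (Algebra.linearMap k A)) := mlt_id.ev h1
      (fun x y => by simp [Algebra.commutes])
    have := congrArg (ev LinearMap.id (Algebra.linearMap k A)) ho
    rw [h.one, map_ev h, ← LinearMap.comp_assoc, ev_iL _ _ h1, ev_iR _ _ mlt_id] at this
    exact this
end Mk

section Ex
set_option linter.unusedSectionVars false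
variable {k H : Type u} [Field k] [Ring H] [HopfAlgebra k H] [FiniteDimensional k H]
  {D : Type u} [Ring D] [Algebra k D]

abbrev E (k H : Type u) [Field k] [Ring H] [HopfAlgebra k H] := Module.End k H

def tau : E k H ⊗[k] D ≃ₗ[k] (H →ₗ[k] H ⊗[k] D) := rTensorHomEquivHomRTensor k H H D

lemma tau_tmul (X : E k H) (d : D) (x : H) : tau (X ⊗ₜ[k] d) x = X x ⊗ₜ d := by
  simp [tau]

lemma tau_ext {w w' : E k H ⊗[k] D} (h : tau w = tau w') : w = w' := tau.injective h

lemma tau_one : tau (1 : E k H ⊗[k] D) = iL k H D := by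
  ext x; rw [Algebra.TensorProduct.one_def, tau_tmul]; rfl

lemma tau_mul (w w' : E k H ⊗[k] D) (x : H) :
    tau (w * w') x = ev (tau w) (iR k H D) (tau w' x) := by
  induction w' with
  | zero => simp
  | add a b ha hb => simp only [mul_add, map_add, LinearMap.add_apply, ha, hb]
  | tmul Y d' =>
    induction w with
    | zero => simp [tau_tmul]
    | add a b ha hb =>
      simp only [tau_tmul, ev_tmul] at ha hb ⊢
      simp only [add_mul, map_add, LinearMap.add_apply, ha, hb]
    | tmul X d => simp [tau_tmul]

def Wf (f : H →ₗ[k] D) : E k H ⊗[k] D := tau.symm (cv (iL k H D) (iR k H D ∘ₗ f))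
def Vf (f : H →ₗ[k] D) : E k H ⊗[k] D := tau.symm (cvop (iL k H D) (iR k H D ∘ₗ f))

lemma tau_W (f : H →ₗ[k] D) : tau (Wf f) = cv (iL k H D) (iR k H D ∘ₗ f) := by simp [Wf]
lemma tau_V (f : H →ₗ[k] D) : tau (Vf f) = cvop (iL k H D) (iR k H D ∘ₗ f) := by simp [Vf]

lemma tau_mul_W (w : E k H ⊗[k] D) (f : H →ₗ[k] D) :
    tau (w * Wf f) = cv (tau w) (iR k H D ∘ₗ f) := by
  ext x
  rw [tau_mul, tau_W, cv_apply, cv_apply]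
  generalize (Coalgebra.comul x : H ⊗[k] H) = z
  induction z with
  | zero => simp
  | add x y hx hy => simp only [map_add, hx, hy]
  | tmul x y => simp

lemma tau_mul_V (w : E k H ⊗[k] D) (f : H →ₗ[k] D) :
    tau (w * Vf f) = cvop (tau w) (iR k H D ∘ₗ f) := by
  ext x
  rw [tau_mul, tau_V]
  simp only [cvop, LinearMap.comp_apply]
  generalize (Coalgebra.comul x : H ⊗[k] H) = z
  induction z with
  | zero => simp
  | add x y hx hy => simp only [map_add, hx, hy]
  | tmul x y => simp

lemma W_mul (f g : H →ₗ[k] D) : Wf f * Wf g = Wf (cv f g) := by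
  apply tau_ext
  rw [tau_mul_W, tau_W, tau_W, cv_assoc, map_cv mlt_iR]
lemma V_mul (f g : H →ₗ[k] D) : Vf f * Vf g = Vf (cvop f g) := by
  apply tau_ext
  rw [tau_mul_V, tau_V, tau_V, cvop_assoc, map_cvop mlt_iR]
lemma V_W {f g : H →ₗ[k] D} (h : Cm f g) : Vf f * Wf g = Wf g * Vf f := by
  apply tau_ext
  have h1 : Cm (iL k H D) (iR k H D ∘ₗ f) := cm_i.comp LinearMap.id _
  have h2 : Cm (iR k H D ∘ₗ g) (iR k H D ∘ₗ f) := fun x y => by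
    simp only [LinearMap.comp_apply, ← mlt_iR.mul, h y x]
  rw [tau_mul_W, tau_mul_V, tau_V, tau_W, cvop_cm h1, cvop_cm (h1.symm.cv h2.symm).symm, cv_assoc]
lemma W_eps : Wf (eps k H D) = 1 := by
  apply tau_ext
  rw [tau_W, tau_one, map_eps mlt_iR, cv_eps]
lemma V_eps : Vf (eps k H D) = 1 := by
  apply tau_ext
  rw [tau_V, tau_one, map_eps mlt_iR, cvop_eps]

lemma tau_map {D' : Type u} [Ring D'] [Algebra k D'] (u : D →ₗ[k] D') (w : E k H ⊗[k] D) :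
    tau (ev (iL k (E k H) D') (iR k (E k H) D' ∘ₗ u) w) =
      ev (iL k H D') (iR k H D' ∘ₗ u) ∘ₗ tau w := by
  ext x
  induction w with
  | zero => simp
  | add a b ha hb => simp only [map_add, LinearMap.add_apply, ha, hb, LinearMap.comp_apply]
  | tmul X d => simp [tau_tmul]

lemma ev_W {D' : Type u} [Ring D'] [Algebra k D'] {u : D →ₗ[k] D'} (hu : Mlt u) (f : H →ₗ[k] D) :
    ev (iL k (E k H) D') (iR k (E k H) D' ∘ₗ u) (Wf f) = Wf (u ∘ₗ f) := by
  apply tau_ext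
  have h1 := mlt_iR (k := k) (A := H) (B := D') |>.comp hu
  have h : Mlt (ev (iL k H D') (iR k H D' ∘ₗ u)) := mlt_iL.ev h1 (cm_i.comp LinearMap.id _)
  rw [tau_map, tau_W, tau_W, map_cv h, ← LinearMap.comp_assoc, ev_iL _ _ h1, ev_iR _ _ mlt_iL]
  rfl
lemma ev_V {D' : Type u} [Ring D'] [Algebra k D'] {u : D →ₗ[k] D'} (hu : Mlt u) (f : H →ₗ[k] D) :
    ev (iL k (E k H) D') (iR k (E k H) D' ∘ₗ u) (Vf f) = Vf (u ∘ₗ f) := by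
  apply tau_ext
  have h1 := mlt_iR (k := k) (A := H) (B := D') |>.comp hu
  have h : Mlt (ev (iL k H D') (iR k H D' ∘ₗ u)) := mlt_iL.ev h1 (cm_i.comp LinearMap.id _)
  rw [tau_map, tau_V, tau_V, map_cvop h, ← LinearMap.comp_assoc, ev_iL _ _ h1, ev_iR _ _ mlt_iL]
  rfl

def Lf (k H : Type u) [Field k] [Ring H] [HopfAlgebra k H] : H →ₗ[k] E k H := LinearMap.mul k H
@[simp] lemma Lf_apply (h x : H) : Lf k H h x = h * x := rfl
lemma mlt_L : Mlt (Lf k H) := ⟨by ext; simp, by intros; ext; simp [mul_assoc]⟩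

def Pf (s : H →ₗ[k] H) : H →ₗ[k] E k H := (LinearMap.mul k H).flip ∘ₗ s
@[simp] lemma Pf_apply (s : H →ₗ[k] H) (h x : H) : Pf s h x = x * s h := rfl

lemma tau_L_mul (h : H) (w : E k H ⊗[k] D) (x : H) :
    tau (iL k (E k H) D (Lf k H h) * w) x = iL k H D h * tau w x := by
  induction w with
  | zero => simp
  | add a b ha hb => simp only [mul_add, map_add, LinearMap.add_apply, ha, hb]
  | tmul X d => simp [tau_tmul]
lemma tau_R_mul (d : D) (w : E k H ⊗[k] D) (x : H) :
    tau (iR k (E k H) D d * w) x = iR k H D d * tau w x := by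
  induction w with
  | zero => simp
  | add a b ha hb => simp only [mul_add, map_add, LinearMap.add_apply, ha, hb]
  | tmul X d => simp [tau_tmul]
lemma tau_mul_L (h : H) (w : E k H ⊗[k] D) (x : H) :
    tau (w * iL k (E k H) D (Lf k H h)) x = tau w (h * x) := by
  induction w with
  | zero => simp
  | add a b ha hb => simp only [add_mul, map_add, LinearMap.add_apply, ha, hb]
  | tmul X d => simp [tau_tmul]

lemma tau_cvRL (h : H) (w : E k H ⊗[k] H) (x : H) :
    tau (cv (iR k (E k H) H) (iL k (E k H) H ∘ₗ Lf k H) h * w) x =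
      cv (iR k H H) (iL k H H) h * tau w x := by
  rw [cv_apply, cv_apply]
  generalize (Coalgebra.comul h : H ⊗[k] H) = z
  induction z with
  | zero => simp
  | add x y hx hy => simp only [map_add, add_mul, LinearMap.add_apply, hx, hy]
  | tmul a b =>
    simp only [ev_tmul, LinearMap.comp_apply, mul_assoc, tau_R_mul, tau_L_mul]
lemma tau_cvLR (h : H) (w : E k H ⊗[k] H) (x : H) :
    tau (cv (iL k (E k H) H ∘ₗ Lf k H) (iR k (E k H) H) h * w) x =
      cv (iL k H H) (iR k H H) h * tau w x := by
  rw [cv_apply, cv_apply]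
  generalize (Coalgebra.comul h : H ⊗[k] H) = z
  induction z with
  | zero => simp
  | add x y hx hy => simp only [map_add, add_mul, LinearMap.add_apply, hx, hy]
  | tmul a b =>
    simp only [ev_tmul, LinearMap.comp_apply, mul_assoc, tau_R_mul, tau_L_mul]

def W0 (k H : Type u) [Field k] [Ring H] [HopfAlgebra k H] [FiniteDimensional k H] :
    E k H ⊗[k] H := Wf LinearMap.id

lemma W_L (h : H) : W0 k H * iL k (E k H) H (Lf k H h) =
    cv (iL k (E k H) H ∘ₗ Lf k H) (iR k (E k H) H) h * W0 k H := by
  apply tau_ext; ext x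
  rw [tau_mul_L, tau_cvLR, W0, tau_W, LinearMap.comp_id]
  exact (mlt_iL.cv mlt_iR cm_i).mul _ _
lemma V_L (h : H) : Vf (LinearMap.id : H →ₗ[k] H) * iL k (E k H) H (Lf k H h) =
    cv (iR k (E k H) H) (iL k (E k H) H ∘ₗ Lf k H) h * Vf (LinearMap.id : H →ₗ[k] H) := by
  apply tau_ext; ext x
  rw [tau_mul_L, tau_cvRL, tau_V, LinearMap.comp_id, cvop_cm cm_i]
  exact (mlt_iR.cv mlt_iL cm_i.symm).mul _ _

variable {s : H →ₗ[k] H} (hs : IsInv s)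

def RM (s : H →ₗ[k] H) : E k H ⊗[k] H := W0 k H * Vf s

include hs
lemma VV : Vf (LinearMap.id : H →ₗ[k] H) * Vf s = 1 := by
  rw [V_mul, hs.id_s, V_eps]
lemma VV' : Vf s * Vf (LinearMap.id : H →ₗ[k] H) = 1 := by
  rw [V_mul, hs.s_id, V_eps]

theorem isYD_M : IsYD (Lf k H) (RM s) := by
  have hev : ∀ (D : Type u) [Ring D] [Algebra k D] (u : H →ₗ[k] D), Mlt u →
      ev (iL k (E k H) D) (iR k (E k H) D ∘ₗ u) (RM s) = Wf u * Vf (u ∘ₗ s) := by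
    intro D _ _ u hu
    have h := Mlt.ev (F := iL k (E k H) D) (G := iR k (E k H) D ∘ₗ u)
      mlt_iL (mlt_iR.comp hu) (cm_i.comp LinearMap.id _)
    rw [RM, h.mul, W0, ev_W hu, ev_V hu]; rfl
  refine mkYD mlt_L ?_ ?_ ?_
  · rw [hev _ _ mlt_iL, hev _ _ mlt_iR, hev _ _ (mlt_iL.cv mlt_iR cm_i), ← W_mul]
    have h1 : cv (iL k H H) (iR k H H) ∘ₗ s = cvop (iL k H H ∘ₗ s) (iR k H H ∘ₗ s) := by
      have h3 : cvop (iR k H H) (iR k H H ∘ₗ s) = eps k H _ := by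
        have := map_cvop (mlt_iR (k := k) (A := H) (B := H)) LinearMap.id s
        rw [hs.id_s, map_eps mlt_iR] at this
        exact this.symm
      rw [← hs.keyS, cvop_assoc, h3, cvop_eps, cv_i]
    rw [h1, ← V_mul]
    have := V_W (cm_i.comp s LinearMap.id : Cm (iL k H H ∘ₗ s) (iR k H H ∘ₗ LinearMap.id))
    rw [LinearMap.comp_id] at this
    simp only [mul_assoc]
    rw [← mul_assoc (Vf _) (Wf _), this, mul_assoc]
  · intro h
    have h1 := V_L (k := k) h
    have h2 : Vf s * cv (iR k (E k H) H) (iL k (E k H) H ∘ₗ Lf k H) h =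
        iL k (E k H) H (Lf k H h) * Vf s := by
      calc _ = Vf s * (cv (iR k (E k H) H) (iL k (E k H) H ∘ₗ Lf k H) h *
              Vf (LinearMap.id : H →ₗ[k] H)) * Vf s := by
            simp only [mul_assoc]; rw [VV hs, mul_one]
        _ = _ := by rw [← h1, ← mul_assoc, VV' hs, one_mul]
    rw [RM, mul_assoc, h2, ← mul_assoc, W_L, mul_assoc]
  · have hu : Mlt (Coalgebra.counit : H →ₗ[k] k) := Mlt.ofAlgHom (Bialgebra.counitAlgHom k H)
    rw [hev _ _ hu]
    have e : (Coalgebra.counit : H →ₗ[k] k) = eps k H k := by ext; simp [eps_apply]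
    have e' : (Coalgebra.counit : H →ₗ[k] k) ∘ₗ s = eps k H k := by
      ext; simp [eps_apply, hs.counit]
    rw [e', e, W_eps, V_eps, one_mul]

lemma mlt_P : Mlt (Pf s) := ⟨by ext; simp [hs.one], by intros; ext; simp [hs.mul, mul_assoc]⟩

def iN (s : H →ₗ[k] H) : H →ₗ[k] E k H := cv (Pf s) (Lf k H)

lemma cm_PL : Cm (Pf s) (Lf k H) := fun x y => by ext; simp [mul_assoc]

lemma W_P (h : H) : W0 k H * cv (iR k (E k H) H) (iL k (E k H) H ∘ₗ Pf s) h =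
    iL k (E k H) H (Pf s h) * W0 k H := by
  apply tau_ext; ext x
  have e1 : ∀ (w : E k H ⊗[k] H) (z : H ⊗[k] H),
      tau (w * ev (iR k (E k H) H) (iL k (E k H) H ∘ₗ Pf s) z) x =
        ev (tau w ∘ₗ LinearMap.mulLeft k x ∘ₗ s) (iR k H H) (TensorProduct.comm k H H z) := by
    intro w z
    induction z with
    | zero => simp
    | add x y hx hy => simp only [map_add, mul_add, LinearMap.add_apply, hx, hy]
    | tmul a b =>
      rw [tau_mul]
      simp only [ev_tmul, iR_apply, LinearMap.comp_apply, iL_apply,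
        Algebra.TensorProduct.tmul_mul_tmul, one_mul, mul_one, tau_tmul, Pf_apply,
        TensorProduct.comm_tmul, LinearMap.mulLeft_apply]
  have e2 : ∀ (w : E k H ⊗[k] H),
      tau (iL k (E k H) H (Pf s h) * w) x = tau w x * iL k H H (s h) := by
    intro w
    induction w with
    | zero => simp
    | add a b ha hb => simp only [mul_add, add_mul, map_add, LinearMap.add_apply, ha, hb]
    | tmul X d => simp [tau_tmul]
  rw [e2, cv_apply, e1]
  have hΔ : Mlt (Coalgebra.comul : H →ₗ[k] H ⊗[k] H) := Mlt.ofAlgHom (Bialgebra.comulAlgHom k H)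
  have tW : tau (W0 k H) = (Coalgebra.comul : H →ₗ[k] H ⊗[k] H) := by
    rw [W0, tau_W, LinearMap.comp_id, cv_i]
  have e3 : tau (W0 k H) ∘ₗ LinearMap.mulLeft k x ∘ₗ s =
      lm (Coalgebra.comul x) (Coalgebra.comul ∘ₗ s) := by
    rw [tW]; ext y; exact hΔ.mul _ _
  rw [e3, ev_lm, tW, lm_apply]
  exact congrArg _ (LinearMap.congr_fun hs.keyS h)

theorem isYD_N : IsYD (iN s) (W0 k H) := by
  have hev : ∀ (D : Type u) [Ring D] [Algebra k D] (u : H →ₗ[k] D), Mlt u →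
      ev (iL k (E k H) D) (iR k (E k H) D ∘ₗ u) (W0 k H) = Wf u := by
    intro D _ _ u hu
    rw [W0, ev_W hu]; rfl
  refine mkYD ((mlt_P hs).cv mlt_L (cm_PL hs)) ?_ ?_ ?_
  · rw [hev _ _ mlt_iL, hev _ _ mlt_iR, hev _ _ (mlt_iL.cv mlt_iR cm_i), ← W_mul]
  · have hP : lm (W0 k H) (cv (iR k (E k H) H) (iL k (E k H) H ∘ₗ Pf s)) =
        rm (iL k (E k H) H ∘ₗ Pf s) (W0 k H) := LinearMap.ext (W_P hs)
    have hL : lm (W0 k H) (iL k (E k H) H ∘ₗ Lf k H) =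
        rm (cv (iL k (E k H) H ∘ₗ Lf k H) (iR k (E k H) H)) (W0 k H) := LinearMap.ext W_L
    have hI : iL k (E k H) H ∘ₗ iN s = cv (iL k (E k H) H ∘ₗ Pf s) (iL k (E k H) H ∘ₗ Lf k H) :=
      map_cv mlt_iL _ _
    rw [hI]
    refine LinearMap.congr_fun (f := lm (W0 k H) (cv (iR k (E k H) H)
      (cv (iL k (E k H) H ∘ₗ Pf s) (iL k (E k H) H ∘ₗ Lf k H)))) (g := rm _ _) ?_
    rw [← cv_assoc, ← cv_lm, hP, cv_mid, hL, cv_rm, cv_assoc]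
  · have hu : Mlt (Coalgebra.counit : H →ₗ[k] k) := Mlt.ofAlgHom (Bialgebra.counitAlgHom k H)
    rw [hev _ _ hu]
    have e : (Coalgebra.counit : H →ₗ[k] k) = eps k H k := by ext; simp [eps_apply]
    rw [e, W_eps]
end Ex

section Concl
variable {k H H' : Type u} [Field k] [Ring H] [HopfAlgebra k H] [FiniteDimensional k H]
  [Ring H'] [HopfAlgebra k H']
set_option linter.unusedSectionVars false

def Lam (y : H) : E k H ⊗[k] E k H →ₗ[k] H :=
  (TensorProduct.rid k H).toLinearMap ∘ₗ TensorProduct.map (LinearMap.applyₗ (1 : H))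
    ((Coalgebra.counit : H →ₗ[k] k) ∘ₗ LinearMap.applyₗ y)

@[simp] lemma Lam_tmul (y : H) (X Y : E k H) :
    Lam y (X ⊗ₜ[k] Y) = (Coalgebra.counit (Y y) : k) • X 1 := by
  simp [Lam]

def kap (y : H) : E k H ⊗[k] H →ₗ[k] H :=
  (TensorProduct.lid k H).toLinearMap ∘ₗ TensorProduct.map
    ((Coalgebra.counit : H →ₗ[k] k) ∘ₗ LinearMap.applyₗ y) LinearMap.id

@[simp] lemma kap_tmul (y : H) (Y : E k H) (b : H) :
    kap y (Y ⊗ₜ[k] b) = (Coalgebra.counit (Y y) : k) • b := by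
  simp [kap]

lemma kap_tau (y : H) (w : E k H ⊗[k] H) : kap y w = ev (eps k H H) LinearMap.id (tau w y) := by
  induction w with
  | zero => simp
  | add a b ha hb => simp only [map_add, LinearMap.add_apply, ha, hb]
  | tmul X d => simp [tau_tmul, eps_apply, Algebra.smul_def]

lemma kap_W (y : H) : kap y (W0 k H) = y := by
  rw [kap_tau, W0, tau_W, LinearMap.comp_id, cv_i]
  exact LinearMap.congr_fun (eps_cv (LinearMap.id : H →ₗ[k] H)) y

def evc (G : H →ₗ[k] H) (y : H) : (E k H ⊗[k] E k H) ⊗[k] H →ₗ[k] H :=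
  LinearMap.mul' k H ∘ₗ TensorProduct.map G (Lam y) ∘ₗ
    (TensorProduct.comm k (E k H ⊗[k] E k H) H).toLinearMap

@[simp] lemma evc_tmul (G : H →ₗ[k] H) (y : H) (u : E k H ⊗[k] E k H) (a : H) :
    evc G y (u ⊗ₜ[k] a) = G a * Lam y u := by
  simp [evc]

variable {s : H →ₗ[k] H} (hs : IsInv s)
include hs
lemma counit_iN (h x : H) : (Coalgebra.counit (iN s h x) : k) =
    Coalgebra.counit h * Coalgebra.counit x := by
  have : ∀ z : H ⊗[k] H, (Coalgebra.counit (ev (Pf s) (Lf k H) z x) : k) =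
      ev (eps k H k) (eps k H k) z * Coalgebra.counit x := by
    intro z
    induction z with
    | zero => simp
    | add a b ha hb => simp only [map_add, LinearMap.add_apply, ha, hb, add_mul]
    | tmul a b => simp [eps_apply, hs.counit]; ring
  rw [iN, cv_apply, this]
  congr 1
  exact LinearMap.congr_fun (cv_eps (eps k H k)) h

lemma Lam_ι (y h : H) (u : E k H ⊗[k] E k H) :
    Lam y (tI (Lf k H) (iN s) h * u) = h * Lam y u := by
  have : ∀ z : H ⊗[k] H, Lam y (ev (iL k (E k H) (E k H) ∘ₗ Lf k H)
      (iR k (E k H) (E k H) ∘ₗ iN s) z * u) = ev LinearMap.id (eps k H H) z * Lam y u := by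
    intro z
    induction z with
    | zero => simp
    | add a b ha hb => simp only [map_add, ha, hb, add_mul]
    | tmul a b =>
      induction u with
      | zero => simp
      | add a b ha hb => simp only [mul_add, map_add, ha, hb]
      | tmul X Y =>
        simp [counit_iN hs, eps_apply, Algebra.algebraMap_eq_smul_one, smul_smul]
        rw [mul_comm]
  rw [tI, cv_apply, this]
  congr 1
  exact LinearMap.congr_fun (cv_eps (LinearMap.id : H →ₗ[k] H)) h

lemma Lam_psi (G : H →ₗ[k] H) (y : H) (w : (E k H ⊗[k] E k H) ⊗[k] H) :
    Lam y (psi (k := k) (A := E k H ⊗[k] E k H) w LinearMap.id (tI (Lf k H) (iN s) ∘ₗ G) 1) =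
      evc G y w := by
  induction w with
  | zero => simp
  | add a b ha hb => simp only [psi_add, map_add, ha, hb]
  | tmul u a => simp [Lam_ι hs]

lemma Lam_tR (G : H →ₗ[k] H) (y : H) (RA RB : E k H ⊗[k] H) :
    evc G y (tR RA RB) =
      ev (G ∘ₗ LinearMap.mulLeft k (kap y RB)) LinearMap.id
        (TensorProduct.comm k _ _ (tau RA 1)) := by
  unfold tR
  induction RA with
  | zero => simp
  | add a b ha hb => simp only [mul_add, map_add, LinearMap.add_apply, ha, hb]
  | tmul X a =>
    induction RB with
    | zero => simp [tau_tmul]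
    | add c b ha hb =>
      simp only [tau_tmul, TensorProduct.comm_tmul, ev_tmul, LinearMap.comp_apply,
        LinearMap.mulLeft_apply] at ha hb ⊢
      simp only [add_mul, map_add, ha, hb]
    | tmul Y b => simp [tau_tmul]

lemma psi_M (G : H →ₗ[k] H) (w : E k H ⊗[k] H) :
    (psi w LinearMap.id (Lf k H ∘ₗ G) 1) 1 =
      ev G LinearMap.id (TensorProduct.comm k _ _ (tau w 1)) := by
  induction w with
  | zero => simp
  | add a b ha hb => simp only [psi_add, map_add, LinearMap.add_apply, ha, hb]
  | tmul u a => simp [tau_tmul]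

lemma psi_N (G : H →ₗ[k] H) (y : H) (w : E k H ⊗[k] H) :
    (Coalgebra.counit ((psi w LinearMap.id (iN s ∘ₗ G) 1) y) : k) =
      Coalgebra.counit (G (kap y w)) := by
  induction w with
  | zero => simp
  | add a b ha hb => simp only [psi_add, map_add, LinearMap.add_apply, ha, hb]
  | tmul u a => simp [counit_iN hs, mul_comm]

lemma tau_RM : tau (RM s) 1 = (1 : H ⊗[k] H) := by
  rw [RM, tau_mul_V, W0, tau_W, LinearMap.comp_id, cv_i, cvop]
  simp [hs.one, Algebra.TensorProduct.one_def]

lemma exp_one (n : ℕ) : expMap k H s (n + 1) 1 = 1 := by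
  induction n with
  | zero => rfl
  | succ n ih =>
    have e : expMap k H s (n + 1 + 1) = cv (expMap k H s (n + 1)) ((s ∘ₗ s) ^ (n + 1)) := rfl
    have h2 : ∀ m, ((s ∘ₗ s) ^ m : H →ₗ[k] H) 1 = 1 := by
      intro m
      induction m with
      | zero => rfl
      | succ m ih => rw [pow_succ]; simp [hs.one, ih]
    rw [e, cv_apply, Bialgebra.comul_one, Algebra.TensorProduct.one_def, ev_tmul, ih, h2, one_mul]

lemma exp_counit (n : ℕ) (x : H) :
    (Coalgebra.counit (expMap k H s (n + 1) x) : k) = Coalgebra.counit x := by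
  induction n generalizing x with
  | zero => rfl
  | succ n ih =>
    have e : expMap k H s (n + 1 + 1) = cv (expMap k H s (n + 1)) ((s ∘ₗ s) ^ (n + 1)) := rfl
    have h2 : ∀ m x, (Coalgebra.counit (((s ∘ₗ s) ^ m : H →ₗ[k] H) x) : k) =
        Coalgebra.counit x := by
      intro m
      induction m with
      | zero => intro x; rfl
      | succ m ih => intro x; rw [pow_succ]; simp [hs.counit, ih]
    have h3 : ∀ z : H ⊗[k] H, (Coalgebra.counit (ev (expMap k H s (n + 1)) ((s ∘ₗ s) ^ (n + 1)) z)
        : k) = ev (eps k H k) (eps k H k) z := by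
      intro z
      induction z with
      | zero => simp
      | add a b ha hb => simp only [map_add, ha, hb]
      | tmul a b => simp [eps_apply, ih, h2]
    rw [e, cv_apply, h3]
    exact LinearMap.congr_fun (cv_eps (eps k H k)) x

theorem concl (n : ℕ)
    (h : mono (Lf k H) (RM s) (iN s) (W0 k H) ^ (n + 1) = 1) :
    expMap k H s (n + 1) = counitUnit k H := by
  have h1 := mono_pow hs (isYD_M hs) (isYD_N hs) (n + 1)
  rw [h, one_mul, phi_pow hs (isYD_M hs), phi_pow hs (isYD_N hs),
    phi_pow hs ((isYD_M hs).tens (isYD_N hs))] at h1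
  ext y
  have h2 := congrArg (Lam y) h1
  rw [Lam_psi hs, Lam_tR hs, Lam_tmul, psi_M hs, psi_N hs, tau_RM hs, kap_W,
    Algebra.TensorProduct.one_def] at h2
  simp only [TensorProduct.comm_tmul, ev_tmul, LinearMap.comp_apply, LinearMap.mulLeft_apply,
    mul_one, LinearMap.id_apply, exp_one hs, exp_counit hs, hs.one, hs.counit] at h2
  have h3 := congrArg (HopfAlgebra.antipode k) h2
  rw [hs.h2] at h3
  rw [h3]
  simp [counitUnit, Algebra.algebraMap_eq_smul_one]

omit hs [FiniteDimensional k H] in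
lemma phi_one {A : Type u} [Ring A] [Algebra k A] {s : H →ₗ[k] H} (hs : IsInv s)
    {ι : H →ₗ[k] A} {R : A ⊗[k] H} (h : IsYD ι R) (n : ℕ)
    (he : expMap k H s (n + 1) = counitUnit k H) : phi s ι R ^ (n + 1) = 1 := by
  rw [phi_pow hs h, he]
  have : ι ∘ₗ s ∘ₗ counitUnit k H = eps k H A := by
    ext x
    simp [counitUnit, eps_apply, Algebra.algebraMap_eq_smul_one, hs.one, h.mi.one]
  rw [this, h.psi_eps mlt_id]

theorem oneDir {s' : H' →ₗ[k] H'} (hs' : IsInv s') {f : H ≃ₐ[k] H'} {J Ji : H ⊗[k] H}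
    (t : Tw f J Ji) (n : ℕ) (he : expMap k H' s' (n + 1) = counitUnit k H') :
    expMap k H s (n + 1) = counitUnit k H := by
  apply concl hs
  have hM := (isYD_M hs).twist t
  have hN := (isYD_N hs).twist t
  have h1 := mono_pow hs' hM hN (n + 1)
  rw [phi_one hs' hM n he, phi_one hs' hN n he, phi_one hs' (hM.tens hN) n he, mul_one,
    ← Algebra.TensorProduct.one_def] at h1
  exact t.mono_pow (isYD_M hs).mi (isYD_N hs).mi _ h1
end Concl

end HT

/-- Invariance of the exponent under twisting.  Let `J ∈ H ⊗ H` be a twist for `H` (invertible,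
with `(Δ ⊗ id)(J)·J₁₂ = (id ⊗ Δ)(J)·J₂₃` and `(ε ⊗ id)(J) = (id ⊗ ε)(J) = 1`), and let `H'`
be the twisted Hopf algebra `H^J`: it has the same underlying algebra (via the algebra
isomorphism `f`), the same counit, comultiplication `Δᴶ(x) = J⁻¹ Δ(x) J`, and bijective
antipode (with inverse `SinvJ`).  Then `exp(H^J) = exp(H)`. -/
theorem hopfExponent_twist {k H H' : Type u} [Field k]
    [Ring H] [HopfAlgebra k H] [FiniteDimensional k H]
    [Ring H'] [HopfAlgebra k H']
    (Sinv : H →ₗ[k] H)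
    (hS1 : Sinv ∘ₗ HopfAlgebra.antipode (R := k) (A := H) = LinearMap.id)
    (hS2 : HopfAlgebra.antipode (R := k) (A := H) ∘ₗ Sinv = LinearMap.id)
    (SinvJ : H' →ₗ[k] H')
    (hS1J : SinvJ ∘ₗ HopfAlgebra.antipode (R := k) (A := H') = LinearMap.id)
    (hS2J : HopfAlgebra.antipode (R := k) (A := H') ∘ₗ SinvJ = LinearMap.id)
    -- the twist `J` and its inverse
    (J Jinv : H ⊗[k] H) (hJ1 : J * Jinv = 1) (hJ2 : Jinv * J = 1)
    -- `(Δ ⊗ id)(J) · (J ⊗ 1) = (id ⊗ Δ)(J) · (1 ⊗ J)` in `(H ⊗ H) ⊗ H`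
    (hJcocycle : TensorProduct.map (Coalgebra.comul (R := k)) LinearMap.id J * (J ⊗ₜ[k] (1 : H))
      = (TensorProduct.assoc k H H H).symm
          (TensorProduct.map LinearMap.id (Coalgebra.comul (R := k)) J)
        * (TensorProduct.assoc k H H H).symm ((1 : H) ⊗ₜ[k] J))
    -- `(ε ⊗ id)(J) = 1` and `(id ⊗ ε)(J) = 1`
    (hJcounit₁ : TensorProduct.lid k H
        (TensorProduct.map (Coalgebra.counit (R := k)) LinearMap.id J) = 1)
    (hJcounit₂ : TensorProduct.rid k H
        (TensorProduct.map LinearMap.id (Coalgebra.counit (R := k)) J) = 1)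
    -- `H'` is `H^J`: same algebra, same counit, comultiplication `J⁻¹ Δ(·) J`
    (f : H ≃ₐ[k] H')
    (hcounit : ∀ x : H, Coalgebra.counit (R := k) (f x) = Coalgebra.counit (R := k) x)
    (hcomul : ∀ x : H, Coalgebra.comul (R := k) (f x)
      = TensorProduct.map f.toLinearMap f.toLinearMap
          (Jinv * Coalgebra.comul (R := k) x * J)) :
    hopfExponent k H' SinvJ = hopfExponent k H Sinv := by
  have c1 : ∀ z : H ⊗[k] H, HT.ev (HT.eps k H H) LinearMap.id z = TensorProduct.lid k H
      (TensorProduct.map (Coalgebra.counit (R := k)) LinearMap.id z) := by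
    intro z
    induction z with
    | zero => simp
    | add a b ha hb => simp only [map_add, ha, hb]
    | tmul a b => simp [HT.eps_apply, Algebra.smul_def]
  have c2 : ∀ z : H ⊗[k] H, HT.ev LinearMap.id (HT.eps k H H) z = TensorProduct.rid k H
      (TensorProduct.map LinearMap.id (Coalgebra.counit (R := k)) z) := by
    intro z
    induction z with
    | zero => simp
    | add a b ha hb => simp only [map_add, ha, hb]
    | tmul a b => simp [HT.eps_apply, Algebra.algebraMap_eq_smul_one]
  have t : HT.Tw f J Jinv :=
    ⟨hJ1, hJ2, fun C _ _ P Q S hP hQ hS a b c => HT.coc_of hJcocycle P Q S hP hQ hS a b c,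
      (c1 J).trans hJcounit₁, (c2 J).trans hJcounit₂, hcounit, hcomul⟩
  have hs : HT.IsInv Sinv := ⟨LinearMap.congr_fun hS1, LinearMap.congr_fun hS2⟩
  have hsJ : HT.IsInv SinvJ := ⟨LinearMap.congr_fun hS1J, LinearMap.congr_fun hS2J⟩
  haveI : FiniteDimensional k H' := Module.Finite.equiv f.toLinearEquiv
  unfold hopfExponent
  congr 1
  ext n
  cases n with
  | zero => simp
  | succ n =>
    exact ⟨fun h => ⟨h.1, HT.oneDir hs hsJ t n h.2⟩,
      fun h => ⟨h.1, HT.oneDir hsJ hs t.swap n h.2⟩⟩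

end
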